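/- arXiv:1801.07002 — 4 statements merged into one kernel-verified Lean document; each statement's English description precedes it below -/
import Mathlib

section
/- Let p, q, n be natural numbers with n ≥ 1, p + q = 2n, and with p − q + 1 congruent to 5 or 7 modulo 8 (as integers). Then the real Clifford algebra Cl_{p,q}(ℝ) is isomorphic, as an ℝ-algebra, to the matrix algebra M_{2^{n−1}}(ℍ) over the real quaternions ℍ. -/
/-- The quadratic form of signature `(p, q)` on `Fin (p+q) → ℝ`:
`Q(v) = ∑_{i < p} v i ^ 2 - ∑_{p ≤ i < p+q} v i ^ 2`. -/
noncomputable def Qpq (p q : ℕ) : QuadraticForm ℝ (Fin (p + q) → ℝ) :=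
  QuadraticMap.weightedSumSquares ℝ
    (fun i : Fin (p + q) => if (i : ℕ) < p then (1 : ℝ) else -1)

open scoped TensorProduct Quaternion

section key
variable {M : Type} [AddCommGroup M] [Module ℝ M] (Q : QuadraticForm ℝ M) (a b : ℝ)

/-- The enlarged form `-(ab) Q ⊥ ⟨a, b⟩`. -/
noncomputable def bigQ : QuadraticForm ℝ (M × (ℝ × ℝ)) :=
  ((-(a * b)) • Q).prod (CliffordAlgebraQuaternion.Q a b)

lemma bigQ_apply (v : M × (ℝ × ℝ)) :
    bigQ Q a b v = -(a * b) * Q v.1 + (a * (v.2.1 * v.2.1) + b * (v.2.2 * v.2.2)) := rfl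

noncomputable def fwdLin : M × (ℝ × ℝ) →ₗ[ℝ] CliffordAlgebra Q ⊗[ℝ] ℍ[ℝ, a, 0, b] :=
  LinearMap.coprod
    ((Algebra.TensorProduct.includeLeft (R := ℝ) (S := ℝ) (B := ℍ[ℝ, a, 0, b])).toLinearMap.comp
        (CliffordAlgebra.ι Q) |> (LinearMap.mulRight ℝ
          ((1 : CliffordAlgebra Q) ⊗ₜ[ℝ] (⟨0, 0, 0, 1⟩ : ℍ[ℝ, a, 0, b]))).comp)
    (LinearMap.coprod (LinearMap.toSpanSingleton ℝ _ (1 ⊗ₜ[ℝ] (⟨0, 1, 0, 0⟩ : ℍ[ℝ, a, 0, b])))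
      (LinearMap.toSpanSingleton ℝ _ (1 ⊗ₜ[ℝ] (⟨0, 0, 1, 0⟩ : ℍ[ℝ, a, 0, b]))))

lemma fwdLin_apply (m : M) (x y : ℝ) : fwdLin Q a b (m, x, y) =
    CliffordAlgebra.ι Q m ⊗ₜ[ℝ] (⟨0, 0, 0, 1⟩ : ℍ[ℝ, a, 0, b]) + 1 ⊗ₜ[ℝ] ⟨0, x, y, 0⟩ := by
  simp [fwdLin, ← TensorProduct.tmul_smul, ← TensorProduct.tmul_add]

noncomputable def fwd :
    CliffordAlgebra (bigQ Q a b) →ₐ[ℝ] CliffordAlgebra Q ⊗[ℝ] ℍ[ℝ, a, 0, b] :=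
  CliffordAlgebra.lift _ ⟨fwdLin Q a b, by
    rintro ⟨m, x, y⟩
    rw [fwdLin_apply, bigQ_apply, add_mul, mul_add, mul_add]
    simp only [Algebra.TensorProduct.tmul_mul_tmul, CliffordAlgebra.ι_sq_scalar, mul_one, one_mul]
    have h1 : (⟨0, 0, 0, 1⟩ : ℍ[ℝ, a, 0, b]) * ⟨0, 0, 0, 1⟩ = algebraMap ℝ _ (-(a * b)) := by
      ext <;> simp
    have h2 : (⟨0, x, y, 0⟩ : ℍ[ℝ, a, 0, b]) * ⟨0, x, y, 0⟩
        = algebraMap ℝ _ (a * (x * x) + b * (y * y)) := by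
      ext <;> simp <;> ring
    have h3 : (⟨0, x, y, 0⟩ : ℍ[ℝ, a, 0, b]) * ⟨0, 0, 0, 1⟩
        = - (⟨0, 0, 0, 1⟩ * ⟨0, x, y, 0⟩) := by
      ext <;> simp
    rw [h1, h2, h3, TensorProduct.tmul_neg]
    simp only [Algebra.algebraMap_eq_smul_one, TensorProduct.tmul_smul, ← TensorProduct.smul_tmul',
      Algebra.TensorProduct.one_def]
    module⟩

lemma fwd_ι (m : M) (x y : ℝ) : fwd Q a b (CliffordAlgebra.ι _ (m, x, y)) =
    CliffordAlgebra.ι Q m ⊗ₜ[ℝ] (⟨0, 0, 0, 1⟩ : ℍ[ℝ, a, 0, b]) + 1 ⊗ₜ[ℝ] ⟨0, x, y, 0⟩ := by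
  rw [fwd, CliffordAlgebra.lift_ι_apply, fwdLin_apply]

noncomputable abbrev E1 : CliffordAlgebra (bigQ Q a b) := CliffordAlgebra.ι _ (0, 1, 0)
noncomputable abbrev E2 : CliffordAlgebra (bigQ Q a b) := CliffordAlgebra.ι _ (0, 0, 1)
noncomputable abbrev EX (m : M) : CliffordAlgebra (bigQ Q a b) := CliffordAlgebra.ι _ (m, 0, 0)

lemma E11 : E1 Q a b * E1 Q a b = algebraMap ℝ _ a := by
  rw [CliffordAlgebra.ι_sq_scalar, bigQ_apply]; simp
lemma E22 : E2 Q a b * E2 Q a b = algebraMap ℝ _ b := by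
  rw [CliffordAlgebra.ι_sq_scalar, bigQ_apply]; simp
lemma EXX (m : M) : EX Q a b m * EX Q a b m = algebraMap ℝ _ (-(a * b) * Q m) := by
  rw [CliffordAlgebra.ι_sq_scalar, bigQ_apply]; simp
lemma E21 : E2 Q a b * E1 Q a b = - (E1 Q a b * E2 Q a b) := by
  apply CliffordAlgebra.ι_mul_ι_comm_of_isOrtho
  simp [QuadraticMap.isOrtho_def, bigQ_apply, add_comm]
lemma E1X (m : M) : E1 Q a b * EX Q a b m = - (EX Q a b m * E1 Q a b) := by
  apply CliffordAlgebra.ι_mul_ι_comm_of_isOrtho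
  simp [QuadraticMap.isOrtho_def, bigQ_apply, add_comm]
lemma E2X (m : M) : E2 Q a b * EX Q a b m = - (EX Q a b m * E2 Q a b) := by
  apply CliffordAlgebra.ι_mul_ι_comm_of_isOrtho
  simp [QuadraticMap.isOrtho_def, bigQ_apply, add_comm]

noncomputable def bas : QuaternionAlgebra.Basis (CliffordAlgebra (bigQ Q a b)) a 0 b where
  i := E1 Q a b
  j := E2 Q a b
  k := E1 Q a b * E2 Q a b
  i_mul_i := by rw [E11]; simp [Algebra.algebraMap_eq_smul_one]
  j_mul_j := by rw [E22]; simp [Algebra.algebraMap_eq_smul_one]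
  i_mul_j := rfl
  j_mul_i := by rw [E21]; simp

lemma E1212 : E1 Q a b * E2 Q a b * (E1 Q a b * E2 Q a b) = algebraMap ℝ _ (-(a * b)) := by
  have := (bas Q a b).k_mul_k
  simpa [bas, Algebra.algebraMap_eq_smul_one] using this

lemma EX12 (m : M) : Commute (EX Q a b m) (E1 Q a b * E2 Q a b) := by
  rw [Commute, SemiconjBy, mul_assoc (E1 Q a b), E2X, mul_neg, ← mul_assoc (E1 Q a b) (EX Q a b m), E1X]
  simp [mul_assoc]

variable {a b} (ha : a * a = 1) (hb : b * b = 1)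

noncomputable def invL (ha : a * a = 1) (hb : b * b = 1) :
    CliffordAlgebra Q →ₐ[ℝ] CliffordAlgebra (bigQ Q a b) :=
  CliffordAlgebra.lift _ ⟨(LinearMap.mulRight ℝ ((-(a * b)) • (E1 Q a b * E2 Q a b))).comp
      ((CliffordAlgebra.ι (bigQ Q a b)).comp (LinearMap.inl ℝ M (ℝ × ℝ))), by
    intro m
    have := EX12 Q a b m
    simp only [LinearMap.comp_apply, LinearMap.mulRight_apply, LinearMap.inl_apply]
    change (EX Q a b m * _) * (EX Q a b m * _) = _
    simp only [mul_smul_comm, smul_mul_assoc]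
    rw [this.symm.mul_mul_mul_comm, EXX, E1212]
    rw [← map_mul, Algebra.algebraMap_eq_smul_one, Algebra.algebraMap_eq_smul_one, smul_smul,
      smul_smul]
    congr 1
    linear_combination (Q m) * (a * a * (b * b) + 1) * (b * b * ha + hb)⟩

lemma invL_ι (m : M) : invL Q ha hb (CliffordAlgebra.ι Q m) =
    EX Q a b m * ((-(a * b)) • (E1 Q a b * E2 Q a b)) := by
  rw [invL, CliffordAlgebra.lift_ι_apply]; rfl

lemma inv_comm (x : CliffordAlgebra Q) (y : ℍ[ℝ, a, 0, b]) :
    Commute (invL Q ha hb x) ((bas Q a b).liftHom y) := by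
  have h1 : ∀ m, Commute (EX Q a b m * ((-(a * b)) • (E1 Q a b * E2 Q a b))) (E1 Q a b) := by
    intro m
    rw [mul_smul_comm]
    apply Commute.smul_left
    rw [Commute, SemiconjBy, mul_assoc, mul_assoc, E21, ← mul_assoc (E1 Q a b) (EX Q a b m), E1X]
    simp [mul_assoc]
  have h2 : ∀ m, Commute (EX Q a b m * ((-(a * b)) • (E1 Q a b * E2 Q a b))) (E2 Q a b) := by
    intro m
    rw [mul_smul_comm]
    apply Commute.smul_left
    rw [Commute, SemiconjBy, mul_assoc, mul_assoc, ← mul_assoc (E2 Q a b) (EX Q a b m), E2X,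
      neg_mul, mul_assoc, ← mul_assoc (E2 Q a b) (E1 Q a b), E21]
    simp [mul_assoc]
  induction x using CliffordAlgebra.induction with
  | algebraMap r => rw [AlgHom.commutes]; exact Algebra.commutes _ _
  | ι m =>
    rw [invL_ι]
    have e : (bas Q a b).liftHom y = algebraMap ℝ _ y.re + y.imI • E1 Q a b + y.imJ • E2 Q a b
      + y.imK • (E1 Q a b * E2 Q a b) := rfl
    rw [e]
    refine Commute.add_right (Commute.add_right (Commute.add_right ?_ ?_) ?_) ?_
    · exact (Algebra.commutes _ _).symm
    · exact (h1 m).smul_right _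
    · exact (h2 m).smul_right _
    · exact ((h1 m).mul_right (h2 m)).smul_right _
  | mul x y hx hy => rw [map_mul]; exact hx.mul_left hy
  | add x y hx hy => rw [map_add]; exact hx.add_left hy

noncomputable def keyEquiv : CliffordAlgebra (bigQ Q a b) ≃ₐ[ℝ]
    CliffordAlgebra Q ⊗[ℝ] ℍ[ℝ, a, 0, b] :=
  AlgEquiv.ofAlgHom (fwd Q a b)
    (Algebra.TensorProduct.lift (invL Q ha hb) (bas Q a b).liftHom (inv_comm Q ha hb))
    (by
      apply Algebra.TensorProduct.ext
      · apply CliffordAlgebra.hom_ext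
        ext m
        simp only [LinearMap.comp_apply, AlgHom.toLinearMap_apply, AlgHom.comp_apply,
          Algebra.TensorProduct.includeLeft_apply, Algebra.TensorProduct.lift_tmul, map_one, mul_one,
          AlgHom.id_apply, invL_ι, map_mul, map_smul, fwd_ι, map_zero, TensorProduct.zero_tmul,
          zero_add]
        have z : (⟨0, 0, 0, 0⟩ : ℍ[ℝ, a, 0, b]) = 0 := rfl
        rw [z, TensorProduct.tmul_zero, add_zero]
        simp only [Algebra.TensorProduct.tmul_mul_tmul, mul_one, 
          ← TensorProduct.tmul_smul]
        congr 1
        ext <;> simp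
        linear_combination b * b * ha + hb
      · ext <;> simp [bas, QuaternionAlgebra.Basis.lift, fwd_ι])
    (by
      apply CliffordAlgebra.hom_ext
      apply LinearMap.ext
      rintro ⟨m, x, y⟩
      simp only [LinearMap.comp_apply, AlgHom.toLinearMap_apply, AlgHom.comp_apply, fwd_ι, map_add,
        Algebra.TensorProduct.lift_tmul, map_one, one_mul, invL_ι, AlgHom.id_apply]
      have e1 : (bas Q a b).liftHom ⟨0, 0, 0, 1⟩ = E1 Q a b * E2 Q a b := by
        simp [bas, QuaternionAlgebra.Basis.lift]
      have e2 : (bas Q a b).liftHom ⟨0, x, y, 0⟩ = x • E1 Q a b + y • E2 Q a b := by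
        simp [bas, QuaternionAlgebra.Basis.lift]
      rw [e1, e2, mul_assoc, smul_mul_assoc, E1212, Algebra.algebraMap_eq_smul_one, smul_smul]
      have : -(a * b) * -(a * b) = 1 := by linear_combination b * b * ha + hb
      rw [this, one_smul, mul_one, ← map_smul, ← map_smul, ← map_add, ← map_add]
      simp)

end key

/-- `(1, b)` quaternion algebras are split. -/
lemma split_quat (b : ℝ) (hb : b * b = 1) :
    Nonempty (ℍ[ℝ, 1, 0, b] ≃ₐ[ℝ] Matrix (Fin 2) (Fin 2) ℝ) := by
  let B : QuaternionAlgebra.Basis (Matrix (Fin 2) (Fin 2) ℝ) (1 : ℝ) 0 b :=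
    { i := !![1, 0; 0, -1]
      j := !![0, b; 1, 0]
      k := !![0, b; -1, 0]
      i_mul_i := by ext i j; fin_cases i <;> fin_cases j <;> simp
      j_mul_j := by ext i j; fin_cases i <;> fin_cases j <;> simp
      i_mul_j := by ext i j; fin_cases i <;> fin_cases j <;> simp
      j_mul_i := by ext i j; fin_cases i <;> fin_cases j <;> simp }
  refine ⟨AlgEquiv.ofBijective B.liftHom ?_⟩
  have hB : ∀ y, B.liftHom y = !![y.re + y.imI, b * y.imJ + b * y.imK;
      y.imJ - y.imK, y.re - y.imI] := by
    intro y
    ext i j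
    fin_cases i <;> fin_cases j <;>
      simp [B, QuaternionAlgebra.Basis.lift, Matrix.algebraMap_matrix_apply] <;> ring
  constructor
  · rw [injective_iff_map_eq_zero]
    intro y hy
    rw [hB] at hy
    have h00 := congrFun (congrFun hy 0) 0
    have h01 := congrFun (congrFun hy 0) 1
    have h10 := congrFun (congrFun hy 1) 0
    have h11 := congrFun (congrFun hy 1) 1
    simp at h00 h01 h10 h11
    have h : y.imJ + y.imK = 0 := by linear_combination b * h01 - (y.imJ + y.imK) * hb
    ext <;> simp <;> linarith
  · intro A
    refine ⟨⟨(A 0 0 + A 1 1) / 2, (A 0 0 - A 1 1) / 2, (b * A 0 1 + A 1 0) / 2,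
      (b * A 0 1 - A 1 0) / 2⟩, ?_⟩
    rw [hB]
    ext i j
    fin_cases i <;> fin_cases j <;> simp <;> try ring_nf
    linear_combination A 0 1 * hb

/-- The signature `(p, q)` form on a product space. -/
noncomputable def Tpq (p q : ℕ) : QuadraticForm ℝ ((Fin p → ℝ) × (Fin q → ℝ)) :=
  (QuadraticMap.weightedSumSquares ℝ (fun _ : Fin p => (1 : ℝ))).prod
    (QuadraticMap.weightedSumSquares ℝ (fun _ : Fin q => (-1 : ℝ)))

lemma Tpq_apply (p q : ℕ) (v : (Fin p → ℝ) × (Fin q → ℝ)) :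
    Tpq p q v = ∑ i, v.1 i * v.1 i - ∑ i, v.2 i * v.2 i := by
  simp [Tpq, QuadraticMap.weightedSumSquares_apply, sub_eq_add_neg]

noncomputable def consL (n : ℕ) : ((Fin n → ℝ) × ℝ) ≃ₗ[ℝ] (Fin (n + 1) → ℝ) where
  toFun v := Fin.cons v.2 v.1
  invFun w := (Fin.tail w, w 0)
  map_add' u v := by ext i; refine Fin.cases ?_ (fun i => ?_) i <;> simp
  map_smul' u v := by ext i; refine Fin.cases ?_ (fun i => ?_) i <;> simp
  left_inv v := by simp
  right_inv v := by simp

lemma consL_sum (n : ℕ) (u : Fin n → ℝ) (x : ℝ) :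
    ∑ i, consL n (u, x) i * consL n (u, x) i = x * x + ∑ i, u i * u i := by
  simp [consL, Fin.sum_univ_succ]

noncomputable def iso11 (p q : ℕ) :
    (bigQ (Tpq p q) 1 (-1)).IsometryEquiv (Tpq (p + 1) (q + 1)) where
  toLinearEquiv := (LinearEquiv.prodProdProdComm ℝ _ _ _ _).trans ((consL p).prodCongr (consL q))
  map_app' := by
    rintro ⟨⟨u, v⟩, x, y⟩
    change Tpq (p + 1) (q + 1) (consL p (u, x), consL q (v, y)) = _
    rw [bigQ_apply, Tpq_apply, Tpq_apply]
    simp only [consL_sum]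
    ring

noncomputable def shuf (p q : ℕ) : (((Fin p → ℝ) × (Fin q → ℝ)) × (ℝ × ℝ)) ≃ₗ[ℝ]
    ((Fin p → ℝ) × (Fin (q + 2) → ℝ)) where
  toFun w := (w.1.1, consL (q + 1) (consL q (w.1.2, w.2.1), w.2.2))
  invFun w := ((w.1, ((consL q).symm ((consL (q + 1)).symm w.2).1).1),
    ((consL q).symm ((consL (q + 1)).symm w.2).1).2, ((consL (q + 1)).symm w.2).2)
  map_add' u v := by
    refine Prod.ext rfl ?_
    simp only [Prod.snd_add, Prod.fst_add]
    rw [← map_add, Prod.mk_add_mk, ← map_add, Prod.mk_add_mk]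
  map_smul' c v := by
    refine Prod.ext rfl ?_
    simp only [Prod.smul_snd, Prod.smul_fst, RingHom.id_apply]
    rw [← map_smul, Prod.smul_mk, ← map_smul, Prod.smul_mk]
  left_inv v := by simp
  right_inv v := by simp

noncomputable def iso02 (p q : ℕ) :
    (bigQ (Tpq p q) (-1) (-1)).IsometryEquiv (Tpq q (p + 2)) where
  toLinearEquiv := ((LinearEquiv.prodComm ℝ _ _).prodCongr (LinearEquiv.refl ℝ _)).trans (shuf q p)
  map_app' := by
    rintro ⟨⟨u, v⟩, x, y⟩
    change Tpq q (p + 2) (v, consL (p + 1) (consL p (u, x), y)) = _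
    rw [bigQ_apply, Tpq_apply, Tpq_apply]
    simp only [consL_sum]
    ring

noncomputable def iso20 (p q : ℕ) :
    (bigQ (Tpq p q) 1 1).IsometryEquiv (Tpq (q + 2) p) where
  toLinearEquiv := (shuf p q).trans (LinearEquiv.prodComm ℝ _ _)
  map_app' := by
    rintro ⟨⟨u, v⟩, x, y⟩
    change Tpq (q + 2) p (consL (q + 1) (consL q (v, x), y), u) = _
    rw [bigQ_apply, Tpq_apply, Tpq_apply]
    simp only [consL_sum]
    ring

noncomputable def isoQT (p q : ℕ) : (Qpq p q).IsometryEquiv (Tpq p q) where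
  toLinearEquiv := (LinearEquiv.funCongrLeft ℝ ℝ finSumFinEquiv).trans
    (LinearEquiv.sumArrowLequivProdArrow _ _ ℝ ℝ)
  map_app' := by
    intro v
    rw [Tpq_apply]
    simp [Qpq, QuadraticMap.weightedSumSquares_apply, Fin.sum_univ_add, sub_eq_add_neg,
      LinearEquiv.funCongrLeft]

noncomputable def iso00 : (Tpq 0 0).IsometryEquiv (0 : QuadraticForm ℝ Unit) where
  toLinearEquiv := LinearEquiv.ofSubsingleton _ _
  map_app' := by
    intro v
    simp [Tpq_apply]

noncomputable def cl00 : CliffordAlgebra (Tpq 0 0) ≃ₐ[ℝ] ℝ :=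
  (CliffordAlgebra.equivOfIsometry iso00).trans CliffordAlgebraRing.equiv

noncomputable def cl11 (p q : ℕ) : CliffordAlgebra (Tpq (p + 1) (q + 1)) ≃ₐ[ℝ]
    CliffordAlgebra (Tpq p q) ⊗[ℝ] Matrix (Fin 2) (Fin 2) ℝ :=
  (CliffordAlgebra.equivOfIsometry (iso11 p q)).symm.trans <|
    (keyEquiv (Tpq p q) (by norm_num) (by norm_num)).trans <|
    Algebra.TensorProduct.congr AlgEquiv.refl (split_quat (-1) (by norm_num)).some

noncomputable def cl20 (p q : ℕ) : CliffordAlgebra (Tpq (q + 2) p) ≃ₐ[ℝ]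
    CliffordAlgebra (Tpq p q) ⊗[ℝ] Matrix (Fin 2) (Fin 2) ℝ :=
  (CliffordAlgebra.equivOfIsometry (iso20 p q)).symm.trans <|
    (keyEquiv (Tpq p q) (by norm_num) (by norm_num)).trans <|
    Algebra.TensorProduct.congr AlgEquiv.refl (split_quat 1 (by norm_num)).some

noncomputable def cl02 (p q : ℕ) : CliffordAlgebra (Tpq q (p + 2)) ≃ₐ[ℝ]
    CliffordAlgebra (Tpq p q) ⊗[ℝ] Quaternion ℝ :=
  (CliffordAlgebra.equivOfIsometry (iso02 p q)).symm.trans <|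
    keyEquiv (Tpq p q) (by norm_num) (by norm_num)

section mat
variable (A B : Type) [Ring A] [Algebra ℝ A] [Ring B] [Algebra ℝ B]

noncomputable def matTensor (m : ℕ) : Matrix (Fin m) (Fin m) A ⊗[ℝ] B ≃ₐ[ℝ]
    Matrix (Fin m) (Fin m) (B ⊗[ℝ] A) :=
  (Algebra.TensorProduct.comm ℝ _ _).trans <|
    (Algebra.TensorProduct.congr AlgEquiv.refl (matrixEquivTensor (Fin m) ℝ A)).trans <|
    (Algebra.TensorProduct.assoc ℝ ℝ ℝ B A (Matrix (Fin m) (Fin m) ℝ)).symm.trans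
    (matrixEquivTensor (Fin m) ℝ (B ⊗[ℝ] A)).symm

noncomputable def matMat (m k : ℕ) : Matrix (Fin m) (Fin m) (Matrix (Fin k) (Fin k) A) ≃ₐ[ℝ]
    Matrix (Fin (m * k)) (Fin (m * k)) A :=
  (Matrix.compAlgEquiv (Fin m) (Fin k) A ℝ).trans (Matrix.reindexAlgEquiv ℝ A finProdFinEquiv)

noncomputable def matTensorMat (m k : ℕ) :
    Matrix (Fin m) (Fin m) A ⊗[ℝ] Matrix (Fin k) (Fin k) ℝ ≃ₐ[ℝ]
    Matrix (Fin (m * k)) (Fin (m * k)) A :=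
  (matTensor A _ m).trans <| (AlgEquiv.mapMatrix
    ((Algebra.TensorProduct.comm ℝ _ _).trans (matrixEquivTensor (Fin k) ℝ A).symm)).trans
    (matMat A m k)
end mat

noncomputable def quatquat : Quaternion ℝ ⊗[ℝ] Quaternion ℝ ≃ₐ[ℝ] Matrix (Fin 4) (Fin 4) ℝ :=
  (Algebra.TensorProduct.congr (((cl02 0 0).trans (Algebra.TensorProduct.congr cl00
    AlgEquiv.refl)).trans (Algebra.TensorProduct.lid ℝ _)).symm AlgEquiv.refl).trans <|
  (cl02 0 2).symm.trans <| (cl11 1 1).trans <|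
  (Algebra.TensorProduct.congr ((cl11 0 0).trans ((Algebra.TensorProduct.congr cl00
    AlgEquiv.refl).trans (Algebra.TensorProduct.lid ℝ _))) AlgEquiv.refl).trans
  (matTensorMat ℝ 2 2)

noncomputable def matOne : ℝ ≃ₐ[ℝ] Matrix (Fin 1) (Fin 1) ℝ :=
  AlgEquiv.ofBijective (Algebra.ofId ℝ (Matrix (Fin 1) (Fin 1) ℝ))
      ⟨(algebraMap ℝ (Matrix (Fin 1) (Fin 1) ℝ)).injective, fun A => ⟨A 0 0, by
        ext i j
        rw [Subsingleton.elim i 0, Subsingleton.elim j 0]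
        simp [Algebra.ofId_apply, Matrix.algebraMap_matrix_apply]⟩⟩

theorem classify (n : ℕ) : ∀ p q : ℕ, p + q = 2 * n →
    ((((p : ℤ) - q) % 8 = 0 ∨ ((p : ℤ) - q) % 8 = 2) →
      Nonempty (CliffordAlgebra (Tpq p q) ≃ₐ[ℝ] Matrix (Fin (2 ^ n)) (Fin (2 ^ n)) ℝ)) ∧
    ((((p : ℤ) - q) % 8 = 4 ∨ ((p : ℤ) - q) % 8 = 6) → ∃ k, n = k + 1 ∧
      Nonempty (CliffordAlgebra (Tpq p q) ≃ₐ[ℝ]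
        Matrix (Fin (2 ^ k)) (Fin (2 ^ k)) (Quaternion ℝ))) := by
  induction n with
  | zero =>
    intro p q h
    obtain rfl : p = 0 := by omega
    obtain rfl : q = 0 := by omega
    refine ⟨fun _ => ⟨cl00.trans ?_⟩, fun h => by simp at h⟩
    exact matOne
  | succ n ih =>
    have mat2 : ∀ p q p' q' : ℕ, p' + q' = 2 * n → ((((p : ℤ) - q) % 8 = 0 ∨ ((p : ℤ) - q) % 8 = 2) →
          (((p' : ℤ) - q') % 8 = 0 ∨ ((p' : ℤ) - q') % 8 = 2)) →
        ((((p : ℤ) - q) % 8 = 4 ∨ ((p : ℤ) - q) % 8 = 6) →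
          (((p' : ℤ) - q') % 8 = 4 ∨ ((p' : ℤ) - q') % 8 = 6)) →
        (CliffordAlgebra (Tpq p q) ≃ₐ[ℝ]
          CliffordAlgebra (Tpq p' q') ⊗[ℝ] Matrix (Fin 2) (Fin 2) ℝ) →
        ((((p : ℤ) - q) % 8 = 0 ∨ ((p : ℤ) - q) % 8 = 2) →
          Nonempty (CliffordAlgebra (Tpq p q) ≃ₐ[ℝ]
            Matrix (Fin (2 ^ (n + 1))) (Fin (2 ^ (n + 1))) ℝ)) ∧
        ((((p : ℤ) - q) % 8 = 4 ∨ ((p : ℤ) - q) % 8 = 6) → ∃ k, n + 1 = k + 1 ∧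
          Nonempty (CliffordAlgebra (Tpq p q) ≃ₐ[ℝ]
            Matrix (Fin (2 ^ k)) (Fin (2 ^ k)) (Quaternion ℝ))) := by
      intro p q p' q' h h0 h4 e
      obtain ⟨i0, i4⟩ := ih p' q' h
      constructor
      · intro hc
        obtain ⟨f⟩ := i0 (h0 hc)
        exact ⟨e.trans <| (Algebra.TensorProduct.congr f AlgEquiv.refl).trans
          (matTensorMat ℝ (2 ^ n) 2)⟩
      · intro hc
        obtain ⟨k, rfl, ⟨f⟩⟩ := i4 (h4 hc)
        exact ⟨k + 1, rfl, ⟨e.trans <| (Algebra.TensorProduct.congr f AlgEquiv.refl).trans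
          (matTensorMat (Quaternion ℝ) (2 ^ k) 2)⟩⟩
    intro p q h
    match p, q, h with
    | p + 1, q + 1, h =>
      exact mat2 _ _ p q (by omega) (by push_cast; omega) (by push_cast; omega) (cl11 p q)
    | p + 2, 0, h =>
      exact mat2 _ _ 0 p (by omega) (by push_cast; omega) (by push_cast; omega) (cl20 0 p)
    | 0, q + 2, h =>
      obtain ⟨i0, i4⟩ := ih q 0 (by omega)
      constructor
      · intro hc
        obtain ⟨k, rfl, ⟨f⟩⟩ := i4 (by push_cast at hc; push_cast; omega)
        refine ⟨(cl02 q 0).trans <| (Algebra.TensorProduct.congr f AlgEquiv.refl).trans <|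
          (matTensor _ _ _).trans <| (AlgEquiv.mapMatrix quatquat).trans <|
          (matMat ℝ (2 ^ k) 4).trans <| Matrix.reindexAlgEquiv ℝ ℝ (finCongr (by ring))⟩
      · intro hc
        obtain ⟨f⟩ := i0 (by push_cast at hc; push_cast; omega)
        exact ⟨n, rfl, ⟨(cl02 q 0).trans <| (Algebra.TensorProduct.congr f AlgEquiv.refl).trans <|
          (matTensor _ _ _).trans <| AlgEquiv.mapMatrix (Algebra.TensorProduct.rid ℝ ℝ _)⟩⟩
    | 1, 0, h => omega
    | 0, 1, h => omega
    | 0, 0, h => omega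

theorem clifford_iso_matrix_quaternion (p q n : ℕ) (hn : 1 ≤ n) (h : p + q = 2 * n)
    (hc : ((p : ℤ) - q + 1) ≡ 5 [ZMOD 8] ∨ ((p : ℤ) - q + 1) ≡ 7 [ZMOD 8]) :
    Nonempty (CliffordAlgebra (Qpq p q) ≃ₐ[ℝ]
      Matrix (Fin (2 ^ (n - 1))) (Fin (2 ^ (n - 1))) (Quaternion ℝ)) := by
  obtain ⟨k, rfl, ⟨f⟩⟩ := (classify n p q h).2 (by unfold Int.ModEq at hc; omega)
  exact ⟨(CliffordAlgebra.equivOfIsometry (isoQT p q)).trans f⟩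
end

section
/- Let p, q, n be natural numbers with p + q = 2n + 1 and with p − q + 1 congruent to 0 or 4 modulo 8 (as integers). Then the real Clifford algebra Cl_{p,q}(ℝ) is isomorphic, as an ℝ-algebra, to the complex matrix algebra M_{2^n}(ℂ) (regarded as an ℝ-algebra). -/
/-- A system of `m` anticommuting square roots of one generating `A` over `ℂ`, whose ordered
product is the scalar `I ^ n`. -/
def GammaSys (A : Type) [Ring A] [Algebra ℂ A] (m n : ℕ) : Prop :=
  ∃ γ : Fin m → A, (∀ i, γ i * γ i = 1) ∧ (∀ i j, i ≠ j → γ i * γ j = -(γ j * γ i)) ∧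
    Algebra.adjoin ℂ (Set.range γ) = ⊤ ∧
    (List.ofFn γ).prod = algebraMap ℂ A (Complex.I ^ n)

theorem GammaSys.map {A B : Type} [Ring A] [Algebra ℂ A] [Ring B] [Algebra ℂ B] {m n : ℕ}
    (h : GammaSys A m n) (e : A ≃ₐ[ℂ] B) : GammaSys B m n := by
  obtain ⟨γ, h1, h2, h3, h4⟩ := h
  refine ⟨fun i => e (γ i), fun i => ?_, fun i j hij => ?_, ?_, ?_⟩
  · rw [← map_mul, h1, map_one]
  · rw [← map_mul, h2 i j hij, map_neg, map_mul]
  · have : Set.range (fun i => e (γ i)) = (e : A →ₐ[ℂ] B) '' Set.range γ := by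
      rw [← Set.range_comp]; rfl
    rw [this, ← AlgHom.map_adjoin, h3, Algebra.map_top, AlgHom.range_eq_top]
    exact e.surjective
  · have : List.ofFn (fun i => e (γ i)) = (List.ofFn γ).map e := by
      rw [List.map_ofFn]; rfl
    rw [this, ← map_list_prod, h4, AlgEquiv.commutes]

theorem GammaSys.zero : GammaSys (Matrix (Fin (2 ^ 0)) (Fin (2 ^ 0)) ℂ) 1 0 := by
  refine ⟨fun _ => 1, fun _ => by simp, fun i j hij => absurd (Subsingleton.elim i j) hij, ?_, ?_⟩
  · rw [eq_top_iff]
    intro x _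
    have : x = algebraMap ℂ _ (x 0 0) := by
      ext i j
      have hi : i = 0 := Subsingleton.elim (α := Fin 1) i 0
      have hj : j = 0 := Subsingleton.elim (α := Fin 1) j 0
      subst hi hj
      simp [Matrix.algebraMap_matrix_apply]
    rw [this]
    exact Subalgebra.algebraMap_mem _ _
  · simp

theorem prod_block {A : Type} [Ring A] {m : ℕ} (γ : Fin m → A) :
    (List.ofFn (fun i => (!![γ i, 0; 0, -γ i] : Matrix (Fin 2) (Fin 2) A))).prod
      = !![(List.ofFn γ).prod, 0; 0, (-1) ^ m * (List.ofFn γ).prod] := by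
  induction m with
  | zero => simp [Matrix.one_fin_two]
  | succ m ih =>
    rw [List.ofFn_succ, List.prod_cons, ih, List.ofFn_succ, List.prod_cons, Matrix.mul_fin_two]
    have : γ 0 * ((-1) ^ m * (List.ofFn fun i => γ i.succ).prod) =
        (-1) ^ m * (γ 0 * (List.ofFn fun i => γ i.succ).prod) := by
      rw [← mul_assoc, ← mul_assoc, ((Commute.neg_one_right (γ 0)).pow_right m).eq]
    simp [pow_succ, this]

theorem GammaSys.step {A : Type} [Ring A] [Algebra ℂ A] {m n : ℕ} (hm : Odd m)
    (h : GammaSys A m n) : GammaSys (Matrix (Fin 2) (Fin 2) A) (m + 2) (n + 1) := by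
  obtain ⟨γ, h1, h2, h3, h4⟩ := h
  set J : A := algebraMap ℂ A Complex.I with hJ
  have hJJ : J * J = -1 := by rw [hJ, ← map_mul, Complex.I_mul_I]; simp
  have hJc : ∀ a : A, J * a = a * J := fun a => Algebra.commutes _ _
  set X : Matrix (Fin 2) (Fin 2) A := !![0, 1; 1, 0] with hX
  set Y : Matrix (Fin 2) (Fin 2) A := !![0, -J; J, 0] with hY
  set Z : Matrix (Fin 2) (Fin 2) A := !![1, 0; 0, -1] with hZ
  set G : Fin m → Matrix (Fin 2) (Fin 2) A := fun i => !![γ i, 0; 0, -γ i] with hG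
  have hXX : X * X = 1 := by simp [hX, Matrix.one_fin_two]
  have hYY : Y * Y = 1 := by simp [hY, Matrix.one_fin_two, hJJ]
  have hXY : X * Y = -(Y * X) := by simp [hX, hY]
  have hXG : ∀ i, X * G i = -(G i * X) := by intro i; simp [hX, hG]
  have hYG : ∀ i, Y * G i = -(G i * Y) := by intro i; simp [hY, hG, hJc]
  have hGG : ∀ i, G i * G i = 1 := by intro i; simp [hG, Matrix.one_fin_two, h1]
  have hGij : ∀ i j, i ≠ j → G i * G j = -(G j * G i) := by
    intro i j hij; simp [hG, h2 i j hij]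
  set gam : Fin (m + 2) → Matrix (Fin 2) (Fin 2) A := Fin.cons X (Fin.cons Y G) with hgam
  have e0 : gam 0 = X := rfl
  have e1 : gam (Fin.succ 0) = Y := rfl
  have e2 : ∀ i : Fin m, gam i.succ.succ = G i := fun i => rfl
  refine ⟨gam, fun i => ?_, fun i j hij => ?_, ?_, ?_⟩
  · refine Fin.cases ?_ (fun i => Fin.cases ?_ (fun i => ?_) i) i
    · exact hXX
    · exact hYY
    · exact hGG i
  · revert hij
    refine Fin.cases ?_ (fun i => Fin.cases ?_ (fun i => ?_) i) i <;>
    refine Fin.cases ?_ (fun j => Fin.cases ?_ (fun j => ?_) j) j <;> intro hij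
    · exact absurd rfl hij
    · exact hXY
    · exact hXG j
    · rw [e0, e1, hXY, neg_neg]
    · exact absurd rfl hij
    · exact hYG j
    · rw [e0, e2, hXG, neg_neg]
    · rw [e1, e2, hYG, neg_neg]
    · exact hGij i j (fun h => hij (by rw [h]))
  · set S := Algebra.adjoin ℂ (Set.range gam) with hS
    have mX : X ∈ S := Algebra.subset_adjoin ⟨0, rfl⟩
    have mY : Y ∈ S := Algebra.subset_adjoin ⟨Fin.succ 0, rfl⟩
    have mG : ∀ i, G i ∈ S := fun i => Algebra.subset_adjoin ⟨i.succ.succ, rfl⟩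
    have mZ : Z ∈ S := by
      have : Z = (-Complex.I) • (X * Y) := by
        have : (-Complex.I) • J = 1 := by
          rw [hJ, Algebra.smul_def, ← map_mul]; simp
        simp only [neg_smul] at this
        simp [hZ, hX, hY, this]
      rw [this]
      exact S.smul_mem (S.mul_mem mX mY) _
    have mD : ∀ a : A, Matrix.scalarAlgHom (Fin 2) ℂ a ∈ S := by
      intro a
      have ha : a ∈ Algebra.adjoin ℂ (Set.range γ) := by rw [h3]; trivial
      have hle : Algebra.adjoin ℂ (Set.range γ) ≤ S.comap (Matrix.scalarAlgHom (Fin 2) ℂ) := by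
        rw [Algebra.adjoin_le_iff]
        rintro _ ⟨i, rfl⟩
        change Matrix.scalarAlgHom (Fin 2) ℂ (γ i) ∈ S
        have : Matrix.scalarAlgHom (Fin 2) ℂ (γ i) = Z * G i := by
          ext i j
          fin_cases i <;> fin_cases j <;> simp [hZ, hG]
        rw [this]
        exact S.mul_mem mZ (mG i)
      exact hle ha
    have m0 : ((1 / 2 : ℂ) • (1 + Z)) ∈ S := S.smul_mem (S.add_mem S.one_mem mZ) _
    have m1 : ((1 / 2 : ℂ) • (1 - Z)) ∈ S := S.smul_mem (S.sub_mem S.one_mem mZ) _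
    have half : (1 / 2 : ℂ) • ((1 : A) + 1) = 1 := by
      rw [smul_add, ← add_smul]; norm_num
    have E0 : ((1 / 2 : ℂ) • (1 + Z)) = !![1, 0; 0, 0] := by
      rw [Matrix.one_fin_two, hZ]
      ext i j
      fin_cases i <;> fin_cases j <;> simp [-smul_add, -one_div, half]
    have E1 : ((1 / 2 : ℂ) • (1 - Z)) = !![0, 0; 0, 1] := by
      rw [Matrix.one_fin_two, hZ]
      ext i j
      fin_cases i <;> fin_cases j <;> simp [-smul_add, -one_div, half]
    rw [E0] at m0
    rw [E1] at m1
    rw [eq_top_iff]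
    intro M _
    have : M = Matrix.scalarAlgHom (Fin 2) ℂ (M 0 0) * !![1, 0; 0, 0]
        + Matrix.scalarAlgHom (Fin 2) ℂ (M 0 1) * (!![1, 0; 0, 0] * X)
        + Matrix.scalarAlgHom (Fin 2) ℂ (M 1 0) * (!![0, 0; 0, 1] * X)
        + Matrix.scalarAlgHom (Fin 2) ℂ (M 1 1) * !![0, 0; 0, 1] := by
      ext i j
      fin_cases i <;> fin_cases j <;> simp [hX, Matrix.mul_apply, Fin.sum_univ_two]
    rw [this]
    exact S.add_mem (S.add_mem (S.add_mem (S.mul_mem (mD _) m0)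
      (S.mul_mem (mD _) (S.mul_mem m0 mX))) (S.mul_mem (mD _) (S.mul_mem m1 mX)))
      (S.mul_mem (mD _) m1)
  · rw [List.ofFn_succ, List.prod_cons, List.ofFn_succ, List.prod_cons]
    simp only [e0, e1, e2]
    rw [hG, prod_block, h4, hm.neg_one_pow]
    have hp : J * algebraMap ℂ A (Complex.I ^ n) = algebraMap ℂ A (Complex.I ^ (n + 1)) := by
      rw [hJ, ← map_mul, pow_succ']
    rw [hX, hY]
    ext i j
    fin_cases i <;> fin_cases j <;>
      simp [Matrix.algebraMap_matrix_apply, -map_pow, hp]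

theorem gammaSys (n : ℕ) :
    GammaSys (Matrix (Fin (2 ^ n)) (Fin (2 ^ n)) ℂ) (2 * n + 1) n := by
  induction n with
  | zero => exact GammaSys.zero
  | succ n ih =>
    have h := GammaSys.step ⟨n, rfl⟩ ih
    have e : Fin 2 × Fin (2 ^ n) ≃ Fin (2 ^ (n + 1)) :=
      finProdFinEquiv.trans (finCongr (by rw [pow_succ']))
    exact h.map ((Matrix.compAlgEquiv (Fin 2) (Fin (2 ^ n)) ℂ ℂ).trans
      (Matrix.reindexAlgEquiv ℂ ℂ e))

theorem prod_smul_ofFn {A : Type} [Ring A] [Algebra ℂ A] {m : ℕ} (c : Fin m → ℂ) (γ : Fin m → A) :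
    (List.ofFn (fun i => c i • γ i)).prod = (∏ i, c i) • (List.ofFn γ).prod := by
  induction m with
  | zero => simp
  | succ m ih =>
    rw [List.ofFn_succ, List.prod_cons, ih, List.ofFn_succ, List.prod_cons, Fin.prod_univ_succ,
      smul_mul_smul_comm]

theorem finrank_clifford {m : ℕ} (Q : QuadraticForm ℝ (Fin m → ℝ)) :
    Module.Finite ℝ (CliffordAlgebra Q) ∧ Module.finrank ℝ (CliffordAlgebra Q) = 2 ^ m := by
  have e := CliffordAlgebra.equivExterior Q
  have b := (Pi.basisFun ℝ (Fin m)).ExteriorAlgebra.map e.symm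
  refine ⟨Module.Finite.of_basis b, ?_⟩
  rw [Module.finrank_eq_card_basis b]
  simp

theorem clifford_iso_matrix_complex (p q n : ℕ) (h : p + q = 2 * n + 1)
    (hc : ((p : ℤ) - q + 1) ≡ 0 [ZMOD 8] ∨ ((p : ℤ) - q + 1) ≡ 4 [ZMOD 8]) :
    Nonempty (CliffordAlgebra (Qpq p q) ≃ₐ[ℝ] Matrix (Fin (2 ^ n)) (Fin (2 ^ n)) ℂ) := by
  have hodd : Odd (q + n) := by
    simp only [Int.ModEq] at hc
    rw [Nat.odd_iff]
    omega
  have hg := gammaSys n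
  rw [← h] at hg
  obtain ⟨γ, h1, h2, h3, h4⟩ := hg
  set w : Fin (p + q) → ℝ := fun i => if (i : ℕ) < p then (1 : ℝ) else -1 with hw
  set c : Fin (p + q) → ℂ := fun i => if (i : ℕ) < p then 1 else Complex.I with hcdef
  have hcw : ∀ i, c i * c i = (w i : ℂ) := by
    intro i
    simp only [hcdef, hw]
    split_ifs <;> simp
  set g : Fin (p + q) → (Matrix (Fin (2 ^ n)) (Fin (2 ^ n)) ℂ) := fun i => c i • γ i with hgdef
  have hgg : ∀ i, g i * g i = algebraMap ℝ (Matrix (Fin (2 ^ n)) (Fin (2 ^ n)) ℂ) (w i) := by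
    intro i
    simp only [hgdef]
    rw [smul_mul_smul_comm, h1, hcw, ← Algebra.algebraMap_eq_smul_one,
      IsScalarTower.algebraMap_apply ℝ ℂ (Matrix (Fin (2 ^ n)) (Fin (2 ^ n)) ℂ)]
    rfl
  have hgij : ∀ i j, i ≠ j → g i * g j = -(g j * g i) := by
    intro i j hij
    simp only [hgdef]
    rw [smul_mul_smul_comm, smul_mul_smul_comm, h2 i j hij, smul_neg, mul_comm]
  set f : (Fin (p + q) → ℝ) →ₗ[ℝ] (Matrix (Fin (2 ^ n)) (Fin (2 ^ n)) ℂ) := Fintype.linearCombination ℝ g with hf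
  have hfsq : ∀ v, f v * f v = algebraMap ℝ (Matrix (Fin (2 ^ n)) (Fin (2 ^ n)) ℂ) (Qpq p q v) := by
    intro v
    have e1 : f v = ∑ i, v i • g i := by simp [hf, Fintype.linearCombination_apply]
    have e2 : f v * f v = ∑ i, ∑ j, (v i * v j) • (g i * g j) := by
      rw [e1, Finset.sum_mul_sum]
      simp only [smul_mul_smul_comm]
    have e3 : f v * f v = ∑ i, ∑ j, (v i * v j) • (g j * g i) := by
      rw [e2, Finset.sum_comm]
      simp only [mul_comm]
    have e4 : (2 : ℝ) • (f v * f v) = (2 : ℝ) • algebraMap ℝ (Matrix (Fin (2 ^ n)) (Fin (2 ^ n)) ℂ) (Qpq p q v) := by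
      rw [two_smul]
      nth_rewrite 1 [e2]
      rw [e3, ← Finset.sum_add_distrib]
      simp only [← Finset.sum_add_distrib, ← smul_add]
      have : ∀ i, ∑ j, (v i * v j) • (g i * g j + g j * g i)
          = (2 : ℝ) • algebraMap ℝ (Matrix (Fin (2 ^ n)) (Fin (2 ^ n)) ℂ) (w i * (v i * v i)) := by
        intro i
        rw [Finset.sum_eq_single i]
        · rw [hgg, ← two_smul ℝ, smul_comm, map_mul, Algebra.smul_def (v i * v i),
            Algebra.commutes]
        · intro j _ hj
          rw [hgij i j hj.symm]; simp
        · simp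
      simp only [this]
      rw [← Finset.smul_sum, ← map_sum]
      congr 2
      simp [Qpq, QuadraticMap.weightedSumSquares_apply, hw]
    exact smul_right_injective (Matrix (Fin (2 ^ n)) (Fin (2 ^ n)) ℂ) (two_ne_zero' ℝ) e4
  set F := CliffordAlgebra.lift (Qpq p q) ⟨f, hfsq⟩ with hF
  have hFr : ∀ i, g i ∈ F.range := by
    intro i
    refine ⟨CliffordAlgebra.ι _ (Pi.single i 1), ?_⟩
    change F _ = _
    rw [hF, CliffordAlgebra.lift_ι_apply]
    simp [hf]
  have hI : algebraMap ℂ (Matrix (Fin (2 ^ n)) (Fin (2 ^ n)) ℂ) Complex.I ∈ F.range := by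
    have hprod : (List.ofFn g).prod ∈ F.range := by
      apply list_prod_mem
      intro x hx
      rw [List.mem_ofFn] at hx
      obtain ⟨i, rfl⟩ := hx
      exact hFr i
    have hpc : ∏ i, c i = Complex.I ^ q := by
      rw [Fin.prod_univ_add]
      simp [hcdef]
    rw [hgdef, prod_smul_ofFn, h4, hpc, Algebra.smul_def, ← map_mul, ← pow_add] at hprod
    obtain ⟨k, hk⟩ := hodd
    rw [hk, pow_succ, pow_mul, Complex.I_sq] at hprod
    rcases neg_one_pow_eq_or ℂ k with hk2 | hk2 <;> rw [hk2] at hprod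
    · simpa using hprod
    · have := neg_mem hprod
      rw [← map_neg] at this
      simpa using this
  have hC : ∀ z : ℂ, algebraMap ℂ (Matrix (Fin (2 ^ n)) (Fin (2 ^ n)) ℂ) z ∈ F.range := by
    intro z
    have : algebraMap ℂ (Matrix (Fin (2 ^ n)) (Fin (2 ^ n)) ℂ) z = algebraMap ℝ (Matrix (Fin (2 ^ n)) (Fin (2 ^ n)) ℂ) z.re + algebraMap ℝ (Matrix (Fin (2 ^ n)) (Fin (2 ^ n)) ℂ) z.im * algebraMap ℂ (Matrix (Fin (2 ^ n)) (Fin (2 ^ n)) ℂ) Complex.I := by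
      rw [IsScalarTower.algebraMap_apply ℝ ℂ (Matrix (Fin (2 ^ n)) (Fin (2 ^ n)) ℂ), IsScalarTower.algebraMap_apply ℝ ℂ (Matrix (Fin (2 ^ n)) (Fin (2 ^ n)) ℂ), ← map_mul,
        ← map_add]
      congr 1
      exact (Complex.re_add_im z).symm
    rw [this]
    exact add_mem (Subalgebra.algebraMap_mem _ _) (mul_mem (Subalgebra.algebraMap_mem _ _) hI)
  have hγ : ∀ i, γ i ∈ F.range := by
    intro i
    have : γ i = algebraMap ℂ (Matrix (Fin (2 ^ n)) (Fin (2 ^ n)) ℂ) (c i)⁻¹ * g i := by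
      have hne : c i ≠ 0 := by
        simp only [hcdef]; split_ifs <;> simp
      rw [← Algebra.smul_def, hgdef, smul_smul, inv_mul_cancel₀ hne, one_smul]
    rw [this]
    exact mul_mem (hC _) (hFr i)
  have hsurj : Function.Surjective F := by
    intro x
    have hx : x ∈ Algebra.adjoin ℂ (Set.range γ) := by rw [h3]; trivial
    change x ∈ F.range
    induction hx using Algebra.adjoin_induction with
    | mem x hx => obtain ⟨i, rfl⟩ := hx; exact hγ i
    | algebraMap r => exact hC r
    | add x y _ _ hx hy => exact add_mem hx hy
    | mul x y _ _ hx hy => exact mul_mem hx hy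
  obtain ⟨hfin, hrank⟩ := finrank_clifford (Qpq p q)
  have hrankA : Module.finrank ℝ (Matrix (Fin (2 ^ n)) (Fin (2 ^ n)) ℂ) = 2 ^ (p + q) := by
    rw [Module.finrank_matrix, Complex.finrank_real_complex]
    simp [h]
    ring
  have hbij : Function.Bijective F := by
    refine ⟨?_, hsurj⟩
    exact (LinearMap.injective_iff_surjective_of_finrank_eq_finrank (f := F.toLinearMap)
      (hrank.trans hrankA.symm)).2 hsurj
  exact ⟨AlgEquiv.ofBijective F hbij⟩
end

section
/- Let p, q, n be natural numbers with n ≥ 1, p + q = 2n + 1, and with p − q + 1 congruent to 6 modulo 8 (as integers). Then the real Clifford algebra Cl_{p,q}(ℝ) is isomorphic, as an ℝ-algebra, to the product algebra M_{2^{n−1}}(ℍ) × M_{2^{n−1}}(ℍ), where ℍ is the real quaternion algebra. -/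
set_option linter.unusedSimpArgs false

/-- `A` is generated by a family of anticommuting elements with prescribed scalar squares. -/
def HasGens (ι : Type) (w : ι → ℝ) (A : Type) [Ring A] [Algebra ℝ A] : Prop :=
  ∃ f : ι → A, (∀ i, f i * f i = algebraMap ℝ A (w i)) ∧
    (∀ i j, i ≠ j → f i * f j = -(f j * f i)) ∧ Algebra.adjoin ℝ (Set.range f) = ⊤

theorem HasGens.reindex {ι κ : Type} {w : ι → ℝ} {w' : κ → ℝ} {A : Type} [Ring A] [Algebra ℝ A]
    (h : HasGens ι w A) (e : ι ≃ κ) (hw : ∀ i, w' (e i) = w i) : HasGens κ w' A := by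
  obtain ⟨f, h1, h2, h3⟩ := h
  refine ⟨f ∘ e.symm, fun i => ?_, fun i j hij => h2 _ _ (by simpa using hij), ?_⟩
  · have := hw (e.symm i)
    simp only [Equiv.apply_symm_apply] at this
    simp [h1, this]
  · rw [e.symm.surjective.range_comp, h3]

theorem HasGens.congr {ι : Type} {w : ι → ℝ} {A B : Type} [Ring A] [Algebra ℝ A]
    [Ring B] [Algebra ℝ B] (h : HasGens ι w A) (e : A ≃ₐ[ℝ] B) : HasGens ι w B := by
  obtain ⟨f, h1, h2, h3⟩ := h
  refine ⟨e ∘ f, fun i => ?_, fun i j hij => ?_, ?_⟩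
  · simp [← map_mul, h1]
  · simp [← map_mul, h2 i j hij]
  · have : Set.range (e ∘ f) = (e : A →ₐ[ℝ] B) '' Set.range f := by
      rw [Set.range_comp]; rfl
    rw [this, ← AlgHom.map_adjoin, h3, Algebra.map_top]
    exact (AlgHom.range_eq_top _).2 e.surjective

theorem HasGens.equiv {n : ℕ} {w : Fin n → ℝ} {A : Type} [Ring A] [Algebra ℝ A]
    (h : HasGens (Fin n) w A) [Module.Finite ℝ A] (hd : Module.finrank ℝ A = 2 ^ n) :
    Nonempty (CliffordAlgebra (QuadraticMap.weightedSumSquares ℝ w) ≃ₐ[ℝ] A) := by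
  obtain ⟨f, h1, h2, h3⟩ := h
  have key : ∀ v : Fin n → ℝ, Fintype.linearCombination ℝ f v * Fintype.linearCombination ℝ f v
      = algebraMap ℝ A (QuadraticMap.weightedSumSquares ℝ w v) := by
    intro v
    have hS : Fintype.linearCombination ℝ f v * Fintype.linearCombination ℝ f v
        = ∑ i, ∑ j, (v i * v j) • (f i * f j) := by
      simp [Fintype.linearCombination_apply, Finset.sum_mul_sum, smul_smul, mul_comm]
    have hS' : Fintype.linearCombination ℝ f v * Fintype.linearCombination ℝ f v
        = ∑ i, ∑ j, (v i * v j) • (f j * f i) := by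
      rw [hS, Finset.sum_comm]
      simp [mul_comm]
    have h2S : (2 : ℝ) • (Fintype.linearCombination ℝ f v * Fintype.linearCombination ℝ f v)
        = (2 : ℝ) • algebraMap ℝ A (QuadraticMap.weightedSumSquares ℝ w v) := by
      rw [two_smul]
      nth_rw 1 [hS]
      rw [hS', ← Finset.sum_add_distrib, QuadraticMap.weightedSumSquares_apply, map_sum,
        Finset.smul_sum]
      refine Finset.sum_congr rfl fun i _ => ?_
      rw [← Finset.sum_add_distrib, Finset.sum_eq_single i]
      · rw [h1, ← two_smul ℝ]
        simp [Algebra.algebraMap_eq_smul_one, smul_smul]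
        ring_nf
      · intro j _ hj
        rw [h2 j i hj]; simp
      · simp
    exact smul_right_injective A (two_ne_zero (α := ℝ)) h2S
  let φ := CliffordAlgebra.lift (QuadraticMap.weightedSumSquares ℝ w)
    ⟨Fintype.linearCombination ℝ f, key⟩
  have hsurj : Function.Surjective φ := by
    rw [← AlgHom.range_eq_top, eq_top_iff, ← h3, Algebra.adjoin_le_iff]
    rintro _ ⟨i, rfl⟩
    refine ⟨CliffordAlgebra.ι _ (Pi.single i 1), ?_⟩
    change φ _ = _
    simp [φ, Fintype.linearCombination_apply_single]
  let b := ((Pi.basisFun ℝ (Fin n)).ExteriorAlgebra).map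
    (CliffordAlgebra.equivExterior (QuadraticMap.weightedSumSquares ℝ w)).symm
  have hf : Module.Finite ℝ (CliffordAlgebra (QuadraticMap.weightedSumSquares ℝ w)) :=
    Module.Finite.of_basis b
  have hr : Module.finrank ℝ (CliffordAlgebra (QuadraticMap.weightedSumSquares ℝ w)) = 2 ^ n := by
    rw [Module.finrank_eq_card_basis b]; simp
  have hinj : Function.Injective φ.toLinearMap :=
    (LinearMap.injective_iff_surjective_of_finrank_eq_finrank (by rw [hr, hd])).2 hsurj
  exact ⟨AlgEquiv.ofBijective φ ⟨hinj, hsurj⟩⟩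

theorem HasGens.matrix {ι : Type} {w : ι → ℝ} {A : Type} [Ring A] [Algebra ℝ A]
    (h : HasGens ι w A) :
    HasGens (ι ⊕ (Fin 1 ⊕ Fin 1)) (Sum.elim w (Sum.elim 1 (-1))) (Matrix (Fin 2) (Fin 2) A) := by
  obtain ⟨f, h1, h2, h3⟩ := h
  let g : ι ⊕ (Fin 1 ⊕ Fin 1) → Matrix (Fin 2) (Fin 2) A :=
    Sum.elim (fun i => !![f i, 0; 0, -f i])
      (Sum.elim (fun _ => !![0, 1; 1, 0]) (fun _ => !![0, 1; -1, 0]))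
  refine ⟨g, ?_, ?_, ?_⟩
  · rintro (i | i | i) <;> ext a b <;> fin_cases a <;> fin_cases b <;>
      simp [g, h1, Matrix.algebraMap_matrix_apply]
  · rintro (i | i | i) (j | j | j) hij
    · have := h2 i j (by simpa using hij)
      ext a b; fin_cases a <;> fin_cases b <;> simp [g, this]
    all_goals first
      | exact absurd (by congr 2; exact Subsingleton.elim _ _) hij
      | ext a b; fin_cases a <;> fin_cases b <;> simp [g]
  · set S := Algebra.adjoin ℝ (Set.range g) with hS
    have hg : ∀ i, g i ∈ S := fun i => Algebra.subset_adjoin ⟨i, rfl⟩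
    have hE : !![0, 1; 1, 0] ∈ S := hg (Sum.inr (Sum.inl 0))
    have hF : !![0, 1; -1, 0] ∈ S := hg (Sum.inr (Sum.inr 0))
    have hD : !![1, 0; 0, -1] ∈ S := by
      have := S.mul_mem hF hE
      simpa [Matrix.mul_fin_two] using this
    have h11 : !![1, 0; 0, 0] ∈ S := by
      have := S.smul_mem (S.add_mem S.one_mem hD) (1/2 : ℝ)
      convert this using 1
      ext a b; fin_cases a <;> fin_cases b <;> simp [← two_smul ℝ (1 : A), smul_smul]
    have h12 : !![0, 1; 0, 0] ∈ S := by
      convert S.mul_mem h11 hE using 1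
      ext a b; fin_cases a <;> fin_cases b <;> simp
    have h21 : !![0, 0; 1, 0] ∈ S := by
      convert S.mul_mem hE h11 using 1
      ext a b; fin_cases a <;> fin_cases b <;> simp
    have h22 : !![0, 0; 0, 1] ∈ S := by
      convert S.mul_mem h21 h12 using 1
      ext a b; fin_cases a <;> fin_cases b <;> simp
    have hdiag : ∀ a : A, !![a, 0; 0, a] ∈ S := by
      intro a
      have ha : a ∈ Algebra.adjoin ℝ (Set.range f) := by rw [h3]; trivial
      induction ha using Algebra.adjoin_induction with
      | mem x hx =>
        obtain ⟨i, rfl⟩ := hx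
        have := S.mul_mem (hg (Sum.inl i)) hD
        simpa [g, Matrix.mul_fin_two] using this
      | algebraMap r =>
        have := S.algebraMap_mem r
        convert this using 1
        ext a b; fin_cases a <;> fin_cases b <;> simp [Matrix.algebraMap_matrix_apply]
      | add x y _ _ hx hy =>
        convert S.add_mem hx hy using 1
        ext a b; fin_cases a <;> fin_cases b <;> simp
      | mul x y _ _ hx hy =>
        convert S.mul_mem hx hy using 1
        simp [Matrix.mul_fin_two]
    rw [eq_top_iff]
    intro M _
    have := S.add_mem
      (S.add_mem (S.mul_mem h11 (hdiag (M 0 0))) (S.mul_mem h12 (hdiag (M 0 1))))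
      (S.add_mem (S.mul_mem h21 (hdiag (M 1 0))) (S.mul_mem h22 (hdiag (M 1 1))))
    convert this using 1
    ext a b; fin_cases a <;> fin_cases b <;> simp

theorem four_anti {A : Type} [Ring A] (a b c d z : A) (ha : a * a = z) (hb : b * b = z)
    (hc : c * c = z) (hd : d * d = z) (hba : b * a = -(a * b)) (hca : c * a = -(a * c))
    (hda : d * a = -(a * d)) (hcb : c * b = -(b * c)) (hdb : d * b = -(b * d))
    (hdc : d * c = -(c * d)) (hz : ∀ x, x * z = z * x) (hzz : z * z = 1) :
    a * b * c * d * a = -(a * (a * b * c * d)) ∧ a * b * c * d * b = -(b * (a * b * c * d)) ∧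
    a * b * c * d * c = -(c * (a * b * c * d)) ∧ a * b * c * d * d = -(d * (a * b * c * d)) ∧
    a * b * c * d * (a * b * c * d) = 1 := by
  have ext2 : ∀ x y w : A, x * y = w → ∀ t, x * (y * t) = w * t := by
    intro x y w h t
    rw [← mul_assoc, h]
  have za := hz a
  have zb := hz b
  have zc := hz c
  have zd := hz d
  clear hz
  refine ⟨?_, ?_, ?_, ?_, ?_⟩ <;>
  simp only [mul_assoc, ha, hb, hc, hd, hba, hca, hda, hcb, hdb, hdc, za, zb, zc, zd, hzz,
    ext2 _ _ _ ha, ext2 _ _ _ hb, ext2 _ _ _ hc, ext2 _ _ _ hd, ext2 _ _ _ hba, ext2 _ _ _ hca,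
    ext2 _ _ _ hda, ext2 _ _ _ hcb, ext2 _ _ _ hdb, ext2 _ _ _ hdc, ext2 _ _ _ za,
    ext2 _ _ _ zb, ext2 _ _ _ zc, ext2 _ _ _ zd, ext2 _ _ _ hzz, neg_mul, mul_neg, neg_neg,
    one_mul, mul_one]

theorem HasGens.flip {ι : Type} {w : ι → ℝ} {A : Type} [Ring A] [Algebra ℝ A] (c : ℝ)
    (hc : c * c = 1)
    (h : HasGens (ι ⊕ Fin 4) (Sum.elim w (fun _ => c)) A) :
    HasGens (ι ⊕ Fin 4) (Sum.elim w (fun _ => -c)) A := by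
  obtain ⟨f, h1, h2, h3⟩ := h
  let e : Fin 4 → A := fun i => f (Sum.inr i)
  have he1 : ∀ i, e i * e i = algebraMap ℝ A c := fun i => h1 (Sum.inr i)
  have he2 : ∀ i j, i ≠ j → e i * e j = -(e j * e i) := fun i j hij =>
    h2 _ _ (by simpa using hij)
  have hfe : ∀ i j, f (Sum.inl i) * e j = -(e j * f (Sum.inl i)) := fun i j =>
    h2 _ _ (by simp)
  let om : A := e 0 * e 1 * e 2 * e 3
  have hom : om = e 0 * e 1 * e 2 * e 3 := rfl
  have hC : ∀ x : A, x * algebraMap ℝ A c = algebraMap ℝ A c * x := fun x =>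
    (Algebra.commutes c x).symm
  have hCC : algebraMap ℝ A c * algebraMap ℝ A c = 1 := by rw [← map_mul, hc, map_one]
  have hanti : ∀ x y z : A, x * y = -(y * x) → z * x * y = -(z * y * x) := by
    intro x y z hxy
    rw [mul_assoc, hxy, mul_neg, mul_assoc]
  have hfo : ∀ i, f (Sum.inl i) * om = om * f (Sum.inl i) := by
    intro i
    have a0 := hfe i 0
    have a1 := hfe i 1
    have a2 := hfe i 2
    have a3 := hfe i 3
    simp only [hom, ← mul_assoc]
    rw [a0, neg_mul, neg_mul, neg_mul, hanti _ _ _ a1, neg_mul, neg_mul, hanti _ _ _ a2, neg_mul,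
      hanti _ _ _ a3]
    simp
  have heo : ∀ i, om * e i = -(e i * om) := by
    intro i
    have h := four_anti (e 0) (e 1) (e 2) (e 3) _ (he1 0) (he1 1) (he1 2) (he1 3)
      (he2 1 0 (by decide)) (he2 2 0 (by decide)) (he2 3 0 (by decide)) (he2 2 1 (by decide))
      (he2 3 1 (by decide)) (he2 3 2 (by decide)) hC hCC
    fin_cases i
    · exact h.1
    · exact h.2.1
    · exact h.2.2.1
    · exact h.2.2.2.1
  have hoo : om * om = 1 := by
    exact (four_anti (e 0) (e 1) (e 2) (e 3) _ (he1 0) (he1 1) (he1 2) (he1 3)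
      (he2 1 0 (by decide)) (he2 2 0 (by decide)) (he2 3 0 (by decide)) (he2 2 1 (by decide))
      (he2 3 1 (by decide)) (he2 3 2 (by decide)) hC hCC).2.2.2.2
  let e' : Fin 4 → A := fun i => e i * om
  have hee : ∀ i j, e' i * e' j = -(e i * e j) := by
    intro i j
    calc e i * om * (e j * om) = e i * (om * e j) * om := by simp only [mul_assoc]
      _ = -(e i * e j * (om * om)) := by rw [heo]; simp only [mul_assoc, mul_neg, neg_mul]
      _ = _ := by rw [hoo, mul_one]
  have hfe' : ∀ i j, f (Sum.inl i) * e' j = -(e' j * f (Sum.inl i)) := by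
    intro i j
    change f (Sum.inl i) * (e j * om) = -(e j * om * f (Sum.inl i))
    rw [← mul_assoc, hfe, neg_mul, mul_assoc (e j) (f (Sum.inl i)) om, hfo,
      ← mul_assoc (e j) om]
  let g : ι ⊕ Fin 4 → A := Sum.elim (fun i => f (Sum.inl i)) e'
  refine ⟨g, ?_, ?_, ?_⟩
  · rintro (i | i)
    · exact h1 (Sum.inl i)
    · simp [g, hee, he1]
  · rintro (i | i) (j | j) hij
    · exact h2 _ _ (by simpa using hij)
    · exact hfe' i j
    · change e' i * f (Sum.inl j) = -(f (Sum.inl j) * e' i)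
      rw [hfe', neg_neg]
    · change e' i * e' j = -(e' j * e' i)
      rw [hee, hee, he2 i j (by simpa using hij)]
  · set S := Algebra.adjoin ℝ (Set.range g) with hS
    have hg : ∀ i, g i ∈ S := fun i => Algebra.subset_adjoin ⟨i, rfl⟩
    have he' : ∀ i, e' i ∈ S := fun i => hg (Sum.inr i)
    have homS : om ∈ S := by
      have := S.mul_mem (S.mul_mem (he' 0) (he' 1)) (S.mul_mem (he' 2) (he' 3))
      rw [hee, hee, neg_mul_neg, ← mul_assoc] at this
      exact this
    rw [eq_top_iff, ← h3, Algebra.adjoin_le_iff]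
    rintro _ ⟨i | i, rfl⟩
    · exact hg (Sum.inl i)
    · have := S.mul_mem (he' i) homS
      change e i * om * om ∈ S at this
      rwa [mul_assoc, hoo, mul_one] at this

theorem quat_units_aux : ∃ I J K : QuaternionAlgebra ℝ (-1) 0 (-1), I * I = -1 ∧ J * J = -1 ∧
    K * K = -1 ∧ I * J = K ∧ J * I = -K ∧ J * K = I ∧ K * J = -I ∧ K * I = J ∧ I * K = -J ∧
    ∀ x : QuaternionAlgebra ℝ (-1) 0 (-1), x = algebraMap ℝ _ x.re + x.imI • I + (x.imJ • J + x.imK • K) := by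
  refine ⟨⟨0, 1, 0, 0⟩, ⟨0, 0, 1, 0⟩, ⟨0, 0, 0, 1⟩, ?_, ?_, ?_, ?_, ?_, ?_, ?_, ?_, ?_, ?_⟩
  on_goal 10 => intro x
  all_goals
    apply QuaternionAlgebra.ext <;> simp [QuaternionAlgebra.algebraMap_eq]

theorem quat_units : ∃ I J K : Quaternion ℝ, I * I = -1 ∧ J * J = -1 ∧
    K * K = -1 ∧ I * J = K ∧ J * I = -K ∧ J * K = I ∧ K * J = -I ∧ K * I = J ∧ I * K = -J ∧
    ∀ x : Quaternion ℝ, x = algebraMap ℝ _ x.re + x.imI • I + (x.imJ • J + x.imK • K) := 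
  quat_units_aux

theorem hasGens_base :
    HasGens (Fin 0 ⊕ Fin 3) (Sum.elim 1 (-1)) (Quaternion ℝ × Quaternion ℝ) := by
  obtain ⟨I, J, K, hII, hJJ, hKK, hIJ, hJI, hJK, hKJ, hKI, hIK, hx⟩ := quat_units
  let g : Fin 0 ⊕ Fin 3 → Quaternion ℝ × Quaternion ℝ :=
    Sum.elim Fin.elim0 ![(I, I), (J, J), (K, -K)]
  refine ⟨g, ?_, ?_, ?_⟩
  · rintro (i | i)
    · exact i.elim0
    · fin_cases i <;> simp [g, hII, hJJ, hKK]
  · rintro (i | i) (j | j) hij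
    · exact i.elim0
    · exact i.elim0
    · exact j.elim0
    · fin_cases i <;> fin_cases j <;> first
        | exact absurd rfl hij
        | simp [g, hIJ, hJI, hJK, hKJ, hKI, hIK]
  · set S := Algebra.adjoin ℝ (Set.range g) with hS
    have hg : ∀ i, g i ∈ S := fun i => Algebra.subset_adjoin ⟨i, rfl⟩
    have hI : (I, I) ∈ S := hg (Sum.inr 0)
    have hJ : (J, J) ∈ S := hg (Sum.inr 1)
    have hK : (K, -K) ∈ S := hg (Sum.inr 2)
    have hKS : (K, K) ∈ S := by
      have := S.mul_mem hI hJ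
      rwa [Prod.mk_mul_mk, hIJ] at this
    have hD : ((1, -1) : Quaternion ℝ × Quaternion ℝ) ∈ S := by
      have := S.neg_mem (S.mul_mem hKS hK)
      simpa [hKK] using this
    have hd : ∀ x : Quaternion ℝ, (x, x) ∈ S := by
      intro x
      have := S.add_mem (S.add_mem (S.algebraMap_mem x.re) (S.smul_mem hI x.imI))
        (S.add_mem (S.smul_mem hJ x.imJ) (S.smul_mem hKS x.imK))
      convert this using 1
      exact Prod.ext (hx x) (hx x)
    rw [eq_top_iff]
    rintro ⟨x, y⟩ _
    convert S.add_mem (hd ((1/2 : ℝ) • (x + y))) (S.mul_mem hD (hd ((1/2 : ℝ) • (x - y)))) using 1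
    rw [Prod.mk_mul_mk, Prod.mk_add_mk, one_mul, neg_one_mul]
    congr 1 <;> module

/-- Signature `(p, q)` version. -/
def HasSig (p q : ℕ) (A : Type) [Ring A] [Algebra ℝ A] : Prop :=
  HasGens (Fin p ⊕ Fin q) (Sum.elim 1 (-1)) A

theorem HasSig.matrix {p q : ℕ} {A : Type} [Ring A] [Algebra ℝ A] (h : HasSig p q A) :
    HasSig (p + 1) (q + 1) (Matrix (Fin 2) (Fin 2) A) := by
  refine (HasGens.matrix h).reindex ((Equiv.sumSumSumComm _ _ _ _).trans
    (Equiv.sumCongr finSumFinEquiv finSumFinEquiv)) ?_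
  rintro ((i | i) | i | i) <;> simp

/-- Moving four generators from one side to the other. -/
def sigEquivLeft (p q : ℕ) : (Fin p ⊕ Fin q) ⊕ Fin 4 ≃ Fin (p + 4) ⊕ Fin q :=
  (Equiv.sumAssoc _ _ _).trans ((Equiv.sumCongr (Equiv.refl _) (Equiv.sumComm _ _)).trans
    ((Equiv.sumAssoc _ _ _).symm.trans (Equiv.sumCongr finSumFinEquiv (Equiv.refl _))))

def sigEquivRight (p q : ℕ) : (Fin p ⊕ Fin q) ⊕ Fin 4 ≃ Fin p ⊕ Fin (q + 4) :=
  (Equiv.sumAssoc _ _ _).trans (Equiv.sumCongr (Equiv.refl _) finSumFinEquiv)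

theorem HasSig.toRight {p q : ℕ} {A : Type} [Ring A] [Algebra ℝ A] (h : HasSig (p + 4) q A) :
    HasSig p (q + 4) A := by
  have h' : HasGens ((Fin p ⊕ Fin q) ⊕ Fin 4) (Sum.elim (Sum.elim 1 (-1)) (fun _ => 1)) A := by
    refine HasGens.reindex h (sigEquivLeft p q).symm ?_
    intro i
    obtain ⟨j, rfl⟩ := (sigEquivLeft p q).surjective i
    rw [Equiv.symm_apply_apply]
    rcases j with ((j | j) | j) <;> simp [sigEquivLeft]
  refine (h'.flip 1 (by norm_num)).reindex (sigEquivRight p q) ?_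
  rintro ((j | j) | j) <;> simp [sigEquivRight]

theorem HasSig.toLeft {p q : ℕ} {A : Type} [Ring A] [Algebra ℝ A] (h : HasSig p (q + 4) A) :
    HasSig (p + 4) q A := by
  have h' : HasGens ((Fin p ⊕ Fin q) ⊕ Fin 4) (Sum.elim (Sum.elim 1 (-1)) (fun _ => -1)) A := by
    refine HasGens.reindex h (sigEquivRight p q).symm ?_
    intro i
    obtain ⟨j, rfl⟩ := (sigEquivRight p q).surjective i
    rw [Equiv.symm_apply_apply]
    rcases j with ((j | j) | j) <;> simp [sigEquivRight]
  refine (h'.flip (-1) (by norm_num)).reindex (sigEquivLeft p q) ?_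
  rintro ((j | j) | j) <;> simp [sigEquivLeft]

/-- The target algebra. -/
abbrev HH (m : ℕ) : Type :=
  Matrix (Fin (2 ^ m)) (Fin (2 ^ m)) (Quaternion ℝ) ×
    Matrix (Fin (2 ^ m)) (Fin (2 ^ m)) (Quaternion ℝ)

noncomputable def matProdEquiv (A B : Type) [Ring A] [Algebra ℝ A] [Ring B] [Algebra ℝ B] :
    Matrix (Fin 2) (Fin 2) (A × B) ≃ₐ[ℝ] Matrix (Fin 2) (Fin 2) A × Matrix (Fin 2) (Fin 2) B :=
  AlgEquiv.ofBijective
    (AlgHom.prod (AlgHom.mapMatrix (AlgHom.fst ℝ A B)) (AlgHom.mapMatrix (AlgHom.snd ℝ A B)))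
    ⟨fun M N h => by
      have h1 := congrArg Prod.fst h
      have h2 := congrArg Prod.snd h
      ext i j
      · exact congrFun (congrFun h1 i) j
      · exact congrFun (congrFun h2 i) j,
    fun M => ⟨Matrix.of fun i j => (M.1 i j, M.2 i j), rfl⟩⟩

noncomputable def matStep (m : ℕ) :
    Matrix (Fin 2) (Fin 2) (Matrix (Fin (2 ^ m)) (Fin (2 ^ m)) (Quaternion ℝ)) ≃ₐ[ℝ]
      Matrix (Fin (2 ^ (m + 1))) (Fin (2 ^ (m + 1))) (Quaternion ℝ) :=
  (Matrix.compAlgEquiv (Fin 2) (Fin (2 ^ m)) (Quaternion ℝ) ℝ).trans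
    (Matrix.reindexAlgEquiv ℝ (Quaternion ℝ)
      (finProdFinEquiv.trans (finCongr (by rw [pow_succ, mul_comm]))))

noncomputable def stepEquiv (m : ℕ) : Matrix (Fin 2) (Fin 2) (HH m) ≃ₐ[ℝ] HH (m + 1) :=
  (matProdEquiv _ _).trans (AlgEquiv.prodCongr (matStep m) (matStep m))

noncomputable def oneEquiv :
    Quaternion ℝ ≃ₐ[ℝ] Matrix (Fin (2 ^ 0)) (Fin (2 ^ 0)) (Quaternion ℝ) :=
  AlgEquiv.ofBijective (Matrix.scalarAlgHom (Fin 1) ℝ)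
    ⟨fun x y h => by simpa using congrFun (congrFun h 0) 0,
    fun M => ⟨M 0 0, by
      refine Matrix.ext (m := Fin 1) (n := Fin 1) fun i j => ?_
      obtain rfl := Subsingleton.elim i 0
      obtain rfl := Subsingleton.elim j 0
      simp⟩⟩

noncomputable def baseEquiv : (Quaternion ℝ × Quaternion ℝ) ≃ₐ[ℝ] HH 0 :=
  AlgEquiv.prodCongr oneEquiv oneEquiv

theorem hasSig_main (m : ℕ) : ∀ p q : ℕ, p + q = 2 * m + 3 → ((p : ℤ) - q + 1) % 8 = 6 →
    HasSig p q (HH m) := by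
  induction m with
  | zero =>
    intro p q h hc
    obtain ⟨rfl, rfl⟩ : p = 0 ∧ q = 3 := by omega
    exact hasGens_base.congr baseEquiv
  | succ m ih =>
    have step : ∀ p q : ℕ, p + q = 2 * m + 3 → ((p : ℤ) - q + 1) % 8 = 6 →
        HasSig (p + 1) (q + 1) (HH (m + 1)) := fun p q h hc =>
      HasGens.congr (ih p q h hc).matrix (stepEquiv m)
    intro p q h hc
    rcases p with _ | p
    · obtain ⟨r, rfl⟩ : ∃ r, q = r + 1 + 4 := ⟨q - 5, by omega⟩
      exact HasSig.toRight (step 3 r (by omega) (by omega))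
    · rcases q with _ | q
      · obtain ⟨r, rfl⟩ : ∃ r, p = r + 4 := ⟨p - 4, by omega⟩
        have := HasSig.toLeft (p := r + 1) (q := 0) (step r 3 (by omega) (by omega))
        exact this
      · exact step p q (by omega) (by omega)

theorem clifford_iso_prod_matrix_quaternion (p q n : ℕ) (hn : 1 ≤ n) (h : p + q = 2 * n + 1)
    (hc : ((p : ℤ) - q + 1) ≡ 6 [ZMOD 8]) :
    Nonempty (CliffordAlgebra (Qpq p q) ≃ₐ[ℝ]
      (Matrix (Fin (2 ^ (n - 1))) (Fin (2 ^ (n - 1))) (Quaternion ℝ) ×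
        Matrix (Fin (2 ^ (n - 1))) (Fin (2 ^ (n - 1))) (Quaternion ℝ))) := by
  obtain ⟨m, rfl⟩ : ∃ m, n = m + 1 := ⟨n - 1, by omega⟩
  have key := hasSig_main m p q (by omega) hc
  have key2 : HasGens (Fin (p + q))
      (fun i : Fin (p + q) => if (i : ℕ) < p then (1 : ℝ) else -1) (HH m) := by
    refine HasGens.reindex key finSumFinEquiv ?_
    rintro (i | i) <;> simp
  refine key2.equiv ?_
  rw [h, Module.finrank_prod, Module.finrank_matrix, Quaternion.finrank_eq_four]
  simp
  ring
end

section
/- Let n be a natural number with n ≥ 1 and N = 2n + 1. Let A be the unital associative ℝ-algebra presented by generators x_0, …, x_{N−1} subject to the relations: x_0² = −1, x_1² = −1, and x_i² = 1 for all i ≥ 2; x_{2k}·x_{2k+1} = −x_{2k+1}·x_{2k} for every 0 ≤ k < n; x_{N−1} commutes with every generator; and x_i·x_j = x_j·x_i for every other pair i ≠ j among the first 2n generators (i.e., whenever {i,j} ⊆ {0,…,2n−1} is not of the form {2k, 2k+1}). Then A is isomorphic, as an ℝ-algebra, to the product algebra M_{2^{n−1}}(ℍ) × M_{2^{n−1}}(ℍ),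 where ℍ is the real quaternion algebra. (This algebra A is the twisted group algebra 𝒜_ℝ(μ_1^{2n+1}) attached to the quadratic form q_1^{2n+1}(x) = x_1x_2 + ⋯ + x_{2n−1}x_{2n} + x_1 + x_2 over the field of two elements.) -/
/-- The relations presenting the twisted group algebra `𝒜_ℝ(μ₁^{2n+1})`:
generators `x_i` (`i : Fin (2n+1)`) with `x_0² = x_1² = -1`, `x_i² = 1` for `i ≥ 2`,
`x_{2k} x_{2k+1} = - x_{2k+1} x_{2k}` for `k < n`, the last generator `x_{2n}`
commuting with every generator, and `x_i x_j = x_j x_i` for every other pair `i ≠ j`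
among the first `2n` generators. -/
inductive Rel13 (n : ℕ) :
    FreeAlgebra ℝ (Fin (2 * n + 1)) → FreeAlgebra ℝ (Fin (2 * n + 1)) → Prop
  | sq (i : Fin (2 * n + 1)) :
      Rel13 n (FreeAlgebra.ι ℝ i * FreeAlgebra.ι ℝ i)
        (if (i : ℕ) < 2 then -1 else 1)
  | anti (k : ℕ) (hk : k < n) :
      Rel13 n
        (FreeAlgebra.ι ℝ (⟨2 * k, by omega⟩ : Fin (2 * n + 1)) *
          FreeAlgebra.ι ℝ (⟨2 * k + 1, by omega⟩ : Fin (2 * n + 1)))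
        (-(FreeAlgebra.ι ℝ (⟨2 * k + 1, by omega⟩ : Fin (2 * n + 1)) *
          FreeAlgebra.ι ℝ (⟨2 * k, by omega⟩ : Fin (2 * n + 1))))
  | commLast (i : Fin (2 * n + 1)) :
      Rel13 n
        (FreeAlgebra.ι ℝ (⟨2 * n, by omega⟩ : Fin (2 * n + 1)) * FreeAlgebra.ι ℝ i)
        (FreeAlgebra.ι ℝ i * FreeAlgebra.ι ℝ (⟨2 * n, by omega⟩ : Fin (2 * n + 1)))
  | comm (i j : Fin (2 * n + 1)) (hij : i ≠ j)
      (hi : (i : ℕ) < 2 * n) (hj : (j : ℕ) < 2 * n)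
      (h : ¬∃ k : ℕ, ((i : ℕ) = 2 * k ∧ (j : ℕ) = 2 * k + 1) ∨
        ((i : ℕ) = 2 * k + 1 ∧ (j : ℕ) = 2 * k)) :
      Rel13 n (FreeAlgebra.ι ℝ i * FreeAlgebra.ι ℝ j) (FreeAlgebra.ι ℝ j * FreeAlgebra.ι ℝ i)

namespace Tw

set_option linter.unusedSimpArgs false

/-- A family satisfying the defining relations. -/
structure Sat (n : ℕ) {B : Type} [Ring B] (x : ℕ → B) : Prop where
  sq : ∀ i, i ≤ 2 * n → x i * x i = if i < 2 then -1 else 1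
  anti : ∀ k, k < n → x (2 * k) * x (2 * k + 1) = -(x (2 * k + 1) * x (2 * k))
  comm : ∀ i j, i ≤ 2 * n → j ≤ 2 * n → i / 2 ≠ j / 2 → x i * x j = x j * x i

/-- The algebra. -/
def A (n : ℕ) : Type := RingQuot (Rel13 n)

noncomputable instance (n : ℕ) : Ring (A n) := inferInstanceAs (Ring (RingQuot (Rel13 n)))
noncomputable instance (n : ℕ) : Algebra ℝ (A n) :=
  inferInstanceAs (Algebra ℝ (RingQuot (Rel13 n)))

/-- The quotient map. -/
noncomputable def mk (n : ℕ) : FreeAlgebra ℝ (Fin (2 * n + 1)) →ₐ[ℝ] A n :=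
  RingQuot.mkAlgHom ℝ (Rel13 n)

theorem mk_rel {n : ℕ} {a b : FreeAlgebra ℝ (Fin (2 * n + 1))} (h : Rel13 n a b) :
    mk n a = mk n b := RingQuot.mkAlgHom_rel ℝ h

theorem mk_surj (n : ℕ) : Function.Surjective (mk n) := RingQuot.mkAlgHom_surjective ℝ (Rel13 n)

/-- The generators. -/
noncomputable def gen (n : ℕ) (i : ℕ) : A n :=
  if h : i < 2 * n + 1 then mk n (FreeAlgebra.ι ℝ ⟨i, h⟩) else 0

theorem gen_of (n : ℕ) (i : ℕ) (h : i < 2 * n + 1) :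
    gen n i = mk n (FreeAlgebra.ι ℝ ⟨i, h⟩) := by
  simp [gen, h]

theorem sat_gen (n : ℕ) : Sat n (gen n) where
  sq i hi := by
    rw [gen_of n i (by omega), ← map_mul, mk_rel (Rel13.sq _)]
    dsimp only
    split_ifs <;> simp
  anti k hk := by
    rw [gen_of n _ (by omega), gen_of n (2 * k + 1) (by omega), ← map_mul,
      mk_rel (Rel13.anti k hk), map_neg, map_mul]
  comm i j hi hj hij := by
    rw [gen_of n i (by omega), gen_of n j (by omega), ← map_mul, ← map_mul]
    by_cases h1 : i = 2 * n
    · subst h1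
      exact mk_rel (Rel13.commLast _)
    by_cases h2 : j = 2 * n
    · subst h2
      exact (mk_rel (Rel13.commLast _)).symm
    refine mk_rel (Rel13.comm _ _ ?_ ?_ ?_ ?_)
    · intro h
      simp only [Fin.mk.injEq] at h
      omega
    · dsimp only; omega
    · dsimp only; omega
    · rintro ⟨k, hk⟩
      dsimp only at hk
      omega

section
variable {n : ℕ} {B : Type} [Ring B] [Algebra ℝ B]

/-- Universal property. -/
noncomputable def lift {x : ℕ → B} (hx : Sat n x) : A n →ₐ[ℝ] B :=
  RingQuot.liftAlgHom ℝ ⟨FreeAlgebra.lift ℝ (fun i : Fin (2 * n + 1) => x i), by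
    intro a b h
    induction h with
    | sq i =>
      have := hx.sq i (by omega)
      simp only [map_mul, FreeAlgebra.lift_ι_apply, this]
      split_ifs <;> simp
    | anti k hk =>
      simpa only [map_mul, map_neg, FreeAlgebra.lift_ι_apply] using hx.anti k hk
    | commLast i =>
      simp only [map_mul, FreeAlgebra.lift_ι_apply]
      by_cases h : (i : ℕ) = 2 * n
      · rw [h]
      · exact hx.comm _ _ (by omega) (by omega) (by omega)
    | comm i j hij hi hj h =>
      simp only [map_mul, FreeAlgebra.lift_ι_apply]
      refine hx.comm _ _ (by omega) (by omega) ?_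
      intro h'
      apply h
      have : (i : ℕ) ≠ j := fun h => hij (Fin.ext h)
      exact ⟨(i : ℕ) / 2, by omega⟩⟩

theorem lift_gen {x : ℕ → B} (hx : Sat n x) (i : ℕ) (hi : i ≤ 2 * n) :
    lift hx (gen n i) = x i := by
  rw [gen_of n i (by omega)]
  refine (RingQuot.liftAlgHom_mkAlgHom_apply ℝ _ _ _).trans ?_
  rw [FreeAlgebra.lift_ι_apply]

theorem hom_ext {f g : A n →ₐ[ℝ] B} (h : ∀ i, i ≤ 2 * n → f (gen n i) = g (gen n i)) : f = g := by
  refine RingQuot.ringQuot_ext' (S := ℝ) (s := Rel13 n) f g ?_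
  apply FreeAlgebra.hom_ext
  funext i
  have := h i (by omega)
  rw [gen_of n i (by omega)] at this
  exact this

/-- Everything in the image of `f` commutes with `b` if generators do. -/
theorem comm_of (f : A n →ₐ[ℝ] B) (b : B) (h : ∀ i, i ≤ 2 * n → f (gen n i) * b = b * f (gen n i))
    (a : A n) : f a * b = b * f a := by
  obtain ⟨a, rfl⟩ := mk_surj n a
  induction a using FreeAlgebra.induction with
  | grade0 r =>
    simp only [AlgHom.commutes]
    exact Algebra.commutes r b
  | grade1 i =>
    have := h i (by omega)
    rw [gen_of n i (by omega)] at this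
    exact this
  | mul a c ha hc =>
    simp only [map_mul] at *
    rw [mul_assoc, hc, ← mul_assoc, ha, mul_assoc]
  | add a c ha hc =>
    simp only [map_add] at *
    rw [add_mul, ha, hc, mul_add]
end

section
variable {R B : Type} [Ring R] [Algebra ℝ R] [Ring B] [Algebra ℝ B]

/-- Hom out of two by two matrices. -/
noncomputable def matHom (φ : R →ₐ[ℝ] B) (p q : B) (hp : p * p = 1) (hq : q * q = 1)
    (hpq : p * q = -(q * p)) (cp : ∀ a, φ a * p = p * φ a) (cq : ∀ a, φ a * q = q * φ a) :
    Matrix (Fin 2) (Fin 2) R →ₐ[ℝ] B :=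
  AlgHom.ofLinearMap
    { toFun := fun M => (1 / 2 : ℝ) • (φ (M 0 0) * (1 + p) + φ (M 0 1) * ((1 + p) * q)
        + φ (M 1 0) * ((1 - p) * q) + φ (M 1 1) * (1 - p))
      map_add' := by
        intro M N
        simp only [Matrix.add_apply, map_add, add_mul, ← smul_add]
        congr 1
        abel
      map_smul' := by
        intro r M
        simp only [Matrix.smul_apply, map_smul, smul_mul_assoc, ← smul_add, RingHom.id_apply]
        rw [smul_comm] }
    (by
      simp only [LinearMap.coe_mk, AddHom.coe_mk, Matrix.one_apply]
      simp only [if_true, zero_ne_one, one_ne_zero, if_false, map_one, one_mul, map_zero, zero_mul,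
        add_zero]
      rw [add_add_sub_cancel, ← two_smul ℝ (1 : B), smul_smul]
      norm_num)
    (by
      intro M N
      have key : ∀ (a b : R) (u v : B), (∀ a, φ a * u = u * φ a) →
          (φ a * u) * (φ b * v) = φ (a * b) * (u * v) := by
        intro a b u v hu
        rw [map_mul, mul_assoc, ← mul_assoc u, ← hu b]
        simp only [mul_assoc]
      have hqp : q * p = -(p * q) := by rw [hpq, neg_neg]
      have hpp : ∀ b, p * (p * b) = b := by intro b; rw [← mul_assoc, hp, one_mul]
      have hqpp : ∀ b, q * (p * b) = -(p * (q * b)) := by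
        intro b; rw [← mul_assoc, hqp, neg_mul, mul_assoc]
      have c1 : ∀ a, φ a * (1 + p) = (1 + p) * φ a := by
        intro a; rw [mul_add, add_mul, cp a]; simp
      have c2 : ∀ a, φ a * (1 - p) = (1 - p) * φ a := by
        intro a; rw [mul_sub, sub_mul, cp a]; simp
      have c3 : ∀ a, φ a * ((1 + p) * q) = ((1 + p) * q) * φ a := by
        intro a; rw [← mul_assoc, c1, mul_assoc, cq, mul_assoc]
      have c4 : ∀ a, φ a * ((1 - p) * q) = ((1 - p) * q) * φ a := by
        intro a; rw [← mul_assoc, c2, mul_assoc, cq, mul_assoc]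
      simp only [LinearMap.coe_mk, AddHom.coe_mk, Matrix.mul_apply, Fin.sum_univ_two]
      have e1 : (1 + p) * (1 + p) = (2 : ℝ) • (1 + p) := by
        rw [two_smul]; simp only [mul_add, add_mul, hp, mul_one, one_mul]; abel
      have e2 : (1 - p) * (1 - p) = (2 : ℝ) • (1 - p) := by
        rw [two_smul]; simp only [mul_sub, sub_mul, hp, mul_one, one_mul]; abel
      have e3 : (1 + p) * (1 - p) = 0 := by
        simp only [mul_sub, add_mul, hp, mul_one, one_mul]; abel
      have e4 : (1 - p) * (1 + p) = 0 := by
        simp only [mul_add, sub_mul, hp, mul_one, one_mul]; abel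
      have q1 : q * (1 + p) = (1 - p) * q := by
        rw [mul_add, sub_mul, hqp]; simp [sub_eq_add_neg]
      have q2 : q * (1 - p) = (1 + p) * q := by
        rw [mul_sub, add_mul, hqp]; simp [sub_eq_add_neg]
      have r1 : ∀ b, (1 + p) * ((1 + p) * b) = (2 : ℝ) • ((1 + p) * b) := by
        intro b; rw [← mul_assoc, e1, smul_mul_assoc]
      have r2 : ∀ b, (1 - p) * ((1 - p) * b) = (2 : ℝ) • ((1 - p) * b) := by
        intro b; rw [← mul_assoc, e2, smul_mul_assoc]
      have r3 : ∀ b, (1 + p) * ((1 - p) * b) = 0 := by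
        intro b; rw [← mul_assoc, e3, zero_mul]
      have r4 : ∀ b, (1 - p) * ((1 + p) * b) = 0 := by
        intro b; rw [← mul_assoc, e4, zero_mul]
      have q1' : ∀ b, q * ((1 + p) * b) = (1 - p) * (q * b) := by
        intro b; rw [← mul_assoc, q1, mul_assoc]
      have q2' : ∀ b, q * ((1 - p) * b) = (1 + p) * (q * b) := by
        intro b; rw [← mul_assoc, q2, mul_assoc]
      have muu : (1 + p) * (1 + p) = (2 : ℝ) • (1 + p) := by
        simp only [mul_assoc, q1, q2, q1', q2', r1, r2, r3, r4, e1, e2, e3, e4, hq, mul_one, smul_zero, mul_zero]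
      have muv : (1 + p) * ((1 + p) * q) = (2 : ℝ) • ((1 + p) * q) := by
        simp only [mul_assoc, q1, q2, q1', q2', r1, r2, r3, r4, e1, e2, e3, e4, hq, mul_one, smul_zero, mul_zero]
      have muw : (1 + p) * ((1 - p) * q) = 0 := by
        simp only [mul_assoc, q1, q2, q1', q2', r1, r2, r3, r4, e1, e2, e3, e4, hq, mul_one, smul_zero, mul_zero]
      have muz : (1 + p) * (1 - p) = 0 := by
        simp only [mul_assoc, q1, q2, q1', q2', r1, r2, r3, r4, e1, e2, e3, e4, hq, mul_one, smul_zero, mul_zero]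
      have mvu : ((1 + p) * q) * (1 + p) = 0 := by
        simp only [mul_assoc, q1, q2, q1', q2', r1, r2, r3, r4, e1, e2, e3, e4, hq, mul_one, smul_zero, mul_zero]
      have mvv : ((1 + p) * q) * ((1 + p) * q) = 0 := by
        simp only [mul_assoc, q1, q2, q1', q2', r1, r2, r3, r4, e1, e2, e3, e4, hq, mul_one, smul_zero, mul_zero]
      have mvw : ((1 + p) * q) * ((1 - p) * q) = (2 : ℝ) • (1 + p) := by
        simp only [mul_assoc, q1, q2, q1', q2', r1, r2, r3, r4, e1, e2, e3, e4, hq, mul_one, smul_zero, mul_zero]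
      have mvz : ((1 + p) * q) * (1 - p) = (2 : ℝ) • ((1 + p) * q) := by
        simp only [mul_assoc, q1, q2, q1', q2', r1, r2, r3, r4, e1, e2, e3, e4, hq, mul_one, smul_zero, mul_zero]
      have mwu : ((1 - p) * q) * (1 + p) = (2 : ℝ) • ((1 - p) * q) := by
        simp only [mul_assoc, q1, q2, q1', q2', r1, r2, r3, r4, e1, e2, e3, e4, hq, mul_one, smul_zero, mul_zero]
      have mwv : ((1 - p) * q) * ((1 + p) * q) = (2 : ℝ) • (1 - p) := by
        simp only [mul_assoc, q1, q2, q1', q2', r1, r2, r3, r4, e1, e2, e3, e4, hq, mul_one, smul_zero, mul_zero]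
      have mww : ((1 - p) * q) * ((1 - p) * q) = 0 := by
        simp only [mul_assoc, q1, q2, q1', q2', r1, r2, r3, r4, e1, e2, e3, e4, hq, mul_one, smul_zero, mul_zero]
      have mwz : ((1 - p) * q) * (1 - p) = 0 := by
        simp only [mul_assoc, q1, q2, q1', q2', r1, r2, r3, r4, e1, e2, e3, e4, hq, mul_one, smul_zero, mul_zero]
      have mzu : (1 - p) * (1 + p) = 0 := by
        simp only [mul_assoc, q1, q2, q1', q2', r1, r2, r3, r4, e1, e2, e3, e4, hq, mul_one, smul_zero, mul_zero]
      have mzv : (1 - p) * ((1 + p) * q) = 0 := by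
        simp only [mul_assoc, q1, q2, q1', q2', r1, r2, r3, r4, e1, e2, e3, e4, hq, mul_one, smul_zero, mul_zero]
      have mzw : (1 - p) * ((1 - p) * q) = (2 : ℝ) • ((1 - p) * q) := by
        simp only [mul_assoc, q1, q2, q1', q2', r1, r2, r3, r4, e1, e2, e3, e4, hq, mul_one, smul_zero, mul_zero]
      have mzz : (1 - p) * (1 - p) = (2 : ℝ) • (1 - p) := by
        simp only [mul_assoc, q1, q2, q1', q2', r1, r2, r3, r4, e1, e2, e3, e4, hq, mul_one, smul_zero, mul_zero]
      clear q1 q2 q1' q2' r1 r2 r3 r4 e1 e2 e3 e4 hqp hpp hqpp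
      generalize (1 + p) * q = v at *
      generalize (1 - p) * q = w at *
      generalize 1 + p = u at *
      generalize 1 - p = z at *
      simp only [smul_mul_assoc, mul_smul_comm]
      simp only [add_mul, mul_add, map_add]
      simp only [key _ _ _ _ c1, key _ _ _ _ c2, key _ _ _ _ c3, key _ _ _ _ c4]
      simp only [muu, muv, muw, muz, mvu, mvv, mvw, mvz, mwu, mwv, mww, mwz, mzu, mzv, mzw, mzz, mul_zero, mul_smul_comm]
      module)

theorem matHom_apply (φ : R →ₐ[ℝ] B) (p q : B) (hp : p * p = 1) (hq : q * q = 1)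
    (hpq : p * q = -(q * p)) (cp : ∀ a, φ a * p = p * φ a) (cq : ∀ a, φ a * q = q * φ a)
    (M : Matrix (Fin 2) (Fin 2) R) :
    matHom φ p q hp hq hpq cp cq M = (1 / 2 : ℝ) • (φ (M 0 0) * (1 + p) + φ (M 0 1) * ((1 + p) * q)
        + φ (M 1 0) * ((1 - p) * q) + φ (M 1 1) * (1 - p)) := rfl
end

/-- Scalar matrices. -/
noncomputable def D (n : ℕ) : A n →ₐ[ℝ] Matrix (Fin 2) (Fin 2) (A n) :=
  Matrix.scalarAlgHom (Fin 2) ℝ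

theorem D_apply (n : ℕ) (a : A n) : D n a = !![a, 0; 0, a] := by
  ext i j
  fin_cases i <;> fin_cases j <;> simp [D]

/-- First special matrix. -/
noncomputable def P (n : ℕ) : Matrix (Fin 2) (Fin 2) (A n) := !![1, 0; 0, -1]
/-- Second special matrix. -/
noncomputable def Q (n : ℕ) : Matrix (Fin 2) (Fin 2) (A n) := !![0, 1; 1, 0]

theorem PP (n : ℕ) : P n * P n = 1 := by
  simp [P, Matrix.one_fin_two]
theorem QQ (n : ℕ) : Q n * Q n = 1 := by
  simp [Q, Matrix.one_fin_two]
theorem PQ (n : ℕ) : P n * Q n = - (Q n * P n) := by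
  simp [P, Q]
theorem DP (n : ℕ) (a : A n) : D n a * P n = P n * D n a := by
  simp [D_apply, P]
theorem DQ (n : ℕ) (a : A n) : D n a * Q n = Q n * D n a := by
  simp [D_apply, Q]

/-- Images of the generators in matrices. -/
noncomputable def up (n : ℕ) (i : ℕ) : Matrix (Fin 2) (Fin 2) (A n) :=
  if i < 2 * n then D n (gen n i) else if i = 2 * n then P n else if i = 2 * n + 1 then Q n
    else D n (gen n (2 * n))

theorem sat_up (n : ℕ) (hn : 1 ≤ n) : Sat (n + 1) (up n) where
  sq i hi := by
    unfold up
    by_cases h1 : i < 2 * n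
    · rw [if_pos h1, ← map_mul, (sat_gen n).sq i (by omega)]
      split_ifs <;> simp
    · rw [if_neg h1, if_neg (show ¬ i < 2 by omega)]
      split_ifs
      · exact PP n
      · exact QQ n
      · rw [← map_mul, (sat_gen n).sq _ (by omega), if_neg (by omega), map_one]
  anti k hk := by
    unfold up
    split_ifs
    all_goals first | omega | skip
    · simp only [← map_mul, ← map_neg]
      rw [(sat_gen n).anti k (by omega)]
    · exact PQ n
  comm i j hi hj hij := by
    unfold up
    split_ifs
    all_goals first
      | omega
      | (simp only [← map_mul]; rw [(sat_gen n).comm _ _ (by omega) (by omega) (by omega)]; done)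
      | exact DP n _
      | exact DQ n _
      | exact (DP n _).symm
      | exact (DQ n _).symm
      | rfl

/-- Images of the generators in the bigger algebra. -/
noncomputable def emb (n : ℕ) (i : ℕ) : A (n + 1) :=
  if i < 2 * n then gen (n + 1) i else gen (n + 1) (2 * n + 2)

theorem sat_emb (n : ℕ) (hn : 1 ≤ n) : Sat n (emb n) where
  sq i hi := by
    unfold emb
    split_ifs with h1 h2 h2
    · rw [(sat_gen (n + 1)).sq _ (by omega), if_pos (by omega)]
    · rw [(sat_gen (n + 1)).sq _ (by omega), if_neg (by omega)]
    · omega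
    · rw [(sat_gen (n + 1)).sq _ (by omega), if_neg (by omega)]
  anti k hk := by
    unfold emb
    rw [if_pos (by omega), if_pos (by omega)]
    exact (sat_gen (n + 1)).anti k (by omega)
  comm i j hi hj hij := by
    unfold emb
    split_ifs
    · exact (sat_gen (n + 1)).comm _ _ (by omega) (by omega) (by omega)
    · exact (sat_gen (n + 1)).comm _ _ (by omega) (by omega) (by omega)
    · exact (sat_gen (n + 1)).comm _ _ (by omega) (by omega) (by omega)
    · rfl

/-- The forward map. -/
noncomputable def F (n : ℕ) (hn : 1 ≤ n) : A (n + 1) →ₐ[ℝ] Matrix (Fin 2) (Fin 2) (A n) :=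
  lift (sat_up n hn)

/-- The embedding. -/
noncomputable def Phi (n : ℕ) (hn : 1 ≤ n) : A n →ₐ[ℝ] A (n + 1) := lift (sat_emb n hn)

theorem Phi_comm (n : ℕ) (hn : 1 ≤ n) (t : ℕ) (ht : t / 2 = n) (a : A n) :
    Phi n hn a * gen (n + 1) t = gen (n + 1) t * Phi n hn a := by
  apply comm_of
  intro i hi
  rw [Phi, lift_gen _ i hi, emb]
  split_ifs
  · exact (sat_gen (n + 1)).comm _ _ (by omega) (by omega) (by omega)
  · exact (sat_gen (n + 1)).comm _ _ (by omega) (by omega) (by omega)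

/-- The backward map. -/
noncomputable def G (n : ℕ) (hn : 1 ≤ n) : Matrix (Fin 2) (Fin 2) (A n) →ₐ[ℝ] A (n + 1) :=
  matHom (Phi n hn) (gen (n + 1) (2 * n)) (gen (n + 1) (2 * n + 1))
    (by rw [(sat_gen (n + 1)).sq _ (by omega), if_neg (by omega)])
    (by rw [(sat_gen (n + 1)).sq _ (by omega), if_neg (by omega)])
    ((sat_gen (n + 1)).anti n (by omega))
    (Phi_comm n hn _ (by omega)) (Phi_comm n hn _ (by omega))

theorem F_Phi (n : ℕ) (hn : 1 ≤ n) (a : A n) : F n hn (Phi n hn a) = D n a := by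
  have : (F n hn).comp (Phi n hn) = D n := by
    apply hom_ext
    intro i hi
    rw [AlgHom.comp_apply, Phi, lift_gen _ i hi, emb, F]
    split_ifs with h
    · rw [lift_gen _ _ (by omega), up, if_pos h]
    · rw [lift_gen _ _ (by omega), up, if_neg (by omega), if_neg (by omega), if_neg (by omega)]
      congr 2
      omega
  exact DFunLike.congr_fun this a

theorem F_G (n : ℕ) (hn : 1 ≤ n) (M : Matrix (Fin 2) (Fin 2) (A n)) : F n hn (G n hn M) = M := by
  have h1 : F n hn (gen (n + 1) (2 * n)) = P n := by
    rw [F, lift_gen _ _ (by omega), up, if_neg (by omega), if_pos rfl]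
  have h2 : F n hn (gen (n + 1) (2 * n + 1)) = Q n := by
    rw [F, lift_gen _ _ (by omega), up, if_neg (by omega), if_neg (by omega), if_pos rfl]
  rw [G, matHom_apply]
  simp only [map_smul, map_add, map_mul, map_sub, map_one, F_Phi, h1, h2]
  have half : ∀ a : A n, (1 / 2 : ℝ) • (a + a) = a := by
    intro a; rw [← two_smul ℝ a, smul_smul]; norm_num
  ext i j
  fin_cases i <;> fin_cases j <;>
    simp [D_apply, P, Q, Matrix.one_fin_two, -one_div, -smul_add, mul_add, half]

theorem G_F (n : ℕ) (hn : 1 ≤ n) (a : A (n + 1)) : G n hn (F n hn a) = a := by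
  have : (G n hn).comp (F n hn) = AlgHom.id ℝ _ := by
    apply hom_ext
    have half : ∀ a : A (n + 1), (1 / 2 : ℝ) • (a + a) = a := by
      intro a; rw [← two_smul ℝ a, smul_smul]; norm_num
    have hD : ∀ a, G n hn (D n a) = Phi n hn a := by
      intro a
      rw [G, matHom_apply]
      simp only [D_apply, Matrix.of_apply, Matrix.cons_val', Matrix.cons_val_zero,
        Matrix.cons_val_one, Matrix.cons_val_fin_one, map_zero, zero_mul, add_zero, ← mul_add]
      rw [add_add_sub_cancel, mul_add, mul_one, half]
    intro i hi
    rw [AlgHom.comp_apply, F, lift_gen _ i hi, up, AlgHom.id_apply]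
    split_ifs with h1 h2 h3
    · rw [hD, Phi, lift_gen _ _ (by omega), emb, if_pos h1]
    · rw [G, matHom_apply, h2]
      simp only [P, Matrix.of_apply, Matrix.cons_val', Matrix.cons_val_zero, Matrix.cons_val_one,
        Matrix.cons_val_fin_one, map_zero, map_one, map_neg, zero_mul, one_mul, add_zero,
        neg_mul, neg_sub]
      rw [add_comm (1 : A (n + 1)), add_add_sub_cancel, half]
    · rw [G, matHom_apply, h3]
      simp [Q, -one_div, -smul_add, half, add_mul, sub_mul]
    · rw [hD, Phi, lift_gen _ _ (by omega), emb, if_neg (by omega)]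
      congr 1
      omega
  exact DFunLike.congr_fun this a

/-- The inductive step. -/
noncomputable def stepEquiv (n : ℕ) (hn : 1 ≤ n) :
    A (n + 1) ≃ₐ[ℝ] Matrix (Fin 2) (Fin 2) (A n) :=
  AlgEquiv.ofAlgHom (F n hn) (G n hn) (AlgHom.ext (F_G n hn)) (AlgHom.ext (G_F n hn))

/-- Matrices over a product. -/
noncomputable def prodMat (m R S : Type) [Fintype m] [DecidableEq m] [Ring R] [Ring S] [Algebra ℝ R]
    [Algebra ℝ S] : Matrix m m (R × S) ≃ₐ[ℝ] Matrix m m R × Matrix m m S :=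
  AlgEquiv.ofBijective
    (AlgHom.prod (AlgHom.mapMatrix (AlgHom.fst ℝ R S)) (AlgHom.mapMatrix (AlgHom.snd ℝ R S)))
    ⟨fun M N h => by
      have h1 := congrArg Prod.fst h
      have h2 := congrArg Prod.snd h
      ext i j
      · exact congrFun (congrFun h1 i) j
      · exact congrFun (congrFun h2 i) j,
     fun ⟨M, N⟩ => ⟨fun i j => (M i j, N i j), rfl⟩⟩

open Quaternion

/-- The unit i. -/
noncomputable def qi : ℍ[ℝ] := (QuaternionAlgebra.Basis.self ℝ (c₁ := -1) (c₂ := 0) (c₃ := -1)).i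
/-- The unit j. -/
noncomputable def qj : ℍ[ℝ] := (QuaternionAlgebra.Basis.self ℝ (c₁ := -1) (c₂ := 0) (c₃ := -1)).j

theorem qi_sq : qi * qi = -1 := by
  ext <;> simp only [Quaternion.re_mul, Quaternion.imI_mul, Quaternion.imJ_mul, Quaternion.imK_mul] <;> simp [qi]
theorem qj_sq : qj * qj = -1 := by
  ext <;> simp only [Quaternion.re_mul, Quaternion.imI_mul, Quaternion.imJ_mul, Quaternion.imK_mul] <;> simp [qj]
theorem qij : qi * qj = -(qj * qi) := by
  ext <;>
    simp only [Quaternion.re_neg, Quaternion.imI_neg, Quaternion.imJ_neg, Quaternion.imK_neg,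
      Quaternion.re_mul, Quaternion.imI_mul, Quaternion.imJ_mul, Quaternion.imK_mul] <;>
    simp [qi, qj]

/-- Images of the generators in the base case. -/
noncomputable def q1 (i : ℕ) : ℍ[ℝ] × ℍ[ℝ] :=
  match i with
  | 0 => (qi, qi)
  | 1 => (qj, qj)
  | _ => (1, -1)

theorem sat_q1 : Sat 1 q1 where
  sq i hi := by
    have hi' : i ≤ 2 := hi
    interval_cases i
    · exact Prod.ext qi_sq qi_sq
    · exact Prod.ext qj_sq qj_sq
    · exact Prod.ext (one_mul _) (neg_one_mul _ |>.trans (neg_neg _))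
  anti k hk := by
    interval_cases k
    exact Prod.ext qij qij
  comm i j hi hj hij := by
    have hi' : i ≤ 2 := hi
    have hj' : j ≤ 2 := hj
    have h0 : ∀ a : ℍ[ℝ], a * -1 = -1 * a := fun a => by rw [mul_neg_one, neg_one_mul]
    have h1 : ∀ a : ℍ[ℝ], a * 1 = 1 * a := fun a => by rw [mul_one, one_mul]
    interval_cases i <;> interval_cases j <;> first
      | omega
      | exact Prod.ext (h1 _) (h0 _)
      | exact (Prod.ext (h1 _) (h0 _)).symm

/-- Quaternion basis in the presented algebra. -/
noncomputable def qb : QuaternionAlgebra.Basis (A 1) (-1 : ℝ) 0 (-1) where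
  i := gen 1 0
  j := gen 1 1
  k := gen 1 0 * gen 1 1
  i_mul_i := by rw [(sat_gen 1).sq 0 (by omega)]; simp
  j_mul_j := by rw [(sat_gen 1).sq 1 (by omega)]; simp
  i_mul_j := rfl
  j_mul_i := by
    have := (sat_gen 1).anti 0 (by omega)
    simp only [mul_zero, zero_add] at this
    rw [this]; simp

/-- The quaternions inside the algebra. -/
noncomputable def qh : ℍ[ℝ] →ₐ[ℝ] A 1 := qb.liftHom

theorem qh_comm (a : ℍ[ℝ]) : qh a * gen 1 2 = gen 1 2 * qh a := by
  have h0 := (sat_gen 1).comm 0 2 (by omega) (by omega) (by omega)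
  have h1 := (sat_gen 1).comm 1 2 (by omega) (by omega) (by omega)
  have h2 : gen 1 0 * gen 1 1 * gen 1 2 = gen 1 2 * (gen 1 0 * gen 1 1) := by
    rw [mul_assoc, h1, ← mul_assoc, h0, mul_assoc]
  have h3 := fun r : ℝ => Algebra.commutes r (gen 1 2)
  have h4 : qh a = qb.lift a := rfl
  rw [h4]
  simp only [QuaternionAlgebra.Basis.lift, add_mul, mul_add, smul_mul_assoc, mul_smul_comm, h3]
  simp only [qb, h0, h1, h2]

/-- Backward map in the base case. -/
noncomputable def baseG : ℍ[ℝ] × ℍ[ℝ] →ₗ[ℝ] A 1 where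
  toFun x := (1 / 2 : ℝ) • (qh x.1 * (1 + gen 1 2) + qh x.2 * (1 - gen 1 2))
  map_add' x y := by
    simp only [Prod.fst_add, Prod.snd_add, map_add, add_mul, ← smul_add]
    congr 1
    abel
  map_smul' r x := by
    simp only [Prod.smul_fst, Prod.smul_snd, map_smul, smul_mul_assoc, ← smul_add,
      RingHom.id_apply]
    rw [smul_comm]

/-- Backward map in the base case, as a homomorphism. -/
noncomputable def baseH : ℍ[ℝ] × ℍ[ℝ] →ₐ[ℝ] A 1 :=
  AlgHom.ofLinearMap baseG
    (by
      simp only [baseG, LinearMap.coe_mk, AddHom.coe_mk, Prod.fst_one, Prod.snd_one, map_one,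
        one_mul]
      rw [add_add_sub_cancel, ← two_smul ℝ (1 : A 1), smul_smul]
      norm_num)
    (by
      intro x y
      have hp : gen 1 2 * gen 1 2 = 1 := by
        rw [(sat_gen 1).sq _ (by omega), if_neg (by omega)]
      have cp := qh_comm
      simp only [baseG, LinearMap.coe_mk, AddHom.coe_mk, Prod.fst_mul, Prod.snd_mul, map_mul]
      generalize gen 1 2 = p at hp cp ⊢
      have c1 : ∀ a, qh a * (1 + p) = (1 + p) * qh a := by
        intro a; rw [mul_add, add_mul, cp a]; simp
      have c2 : ∀ a, qh a * (1 - p) = (1 - p) * qh a := by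
        intro a; rw [mul_sub, sub_mul, cp a]; simp
      have key : ∀ (a b) (u v : A 1), (∀ a, qh a * u = u * qh a) →
          (qh a * u) * (qh b * v) = qh a * qh b * (u * v) := by
        intro a b u v hu
        rw [mul_assoc, ← mul_assoc u, ← hu b]
        simp only [mul_assoc]
      have e1 : (1 + p) * (1 + p) = (2 : ℝ) • (1 + p) := by
        rw [two_smul]; simp only [mul_add, add_mul, hp, mul_one, one_mul]; abel
      have e2 : (1 - p) * (1 - p) = (2 : ℝ) • (1 - p) := by
        rw [two_smul]; simp only [mul_sub, sub_mul, hp, mul_one, one_mul]; abel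
      have e3 : (1 + p) * (1 - p) = 0 := by
        simp only [mul_sub, add_mul, hp, mul_one, one_mul]; abel
      have e4 : (1 - p) * (1 + p) = 0 := by
        simp only [mul_add, sub_mul, hp, mul_one, one_mul]; abel
      rw [smul_mul_smul_comm, add_mul, mul_add (qh x.1 * (1 + p)), mul_add (qh x.2 * (1 - p)),
        key _ _ _ _ c1, key _ _ _ _ c1, key _ _ _ _ c2, key _ _ _ _ c2, e1, e2, e3, e4]
      simp only [mul_zero, add_zero, zero_add, mul_smul_comm]
      module)

theorem baseH_apply (x : ℍ[ℝ] × ℍ[ℝ]) :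
    baseH x = (1 / 2 : ℝ) • (qh x.1 * (1 + gen 1 2) + qh x.2 * (1 - gen 1 2)) := rfl

theorem qh_i : qh qi = gen 1 0 := by
  have h4 : qh qi = qb.lift qi := rfl
  rw [h4]
  simp [QuaternionAlgebra.Basis.lift, qb, qi]

theorem qh_j : qh qj = gen 1 1 := by
  have h4 : qh qj = qb.lift qj := rfl
  rw [h4]
  simp [QuaternionAlgebra.Basis.lift, qb, qj]

/-- Base case. -/
noncomputable def baseEquiv : A 1 ≃ₐ[ℝ] ℍ[ℝ] × ℍ[ℝ] :=
  AlgEquiv.ofAlgHom (lift sat_q1) baseH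
    (by
      have hq : ∀ a, lift sat_q1 (qh a) = (a, a) := by
        intro a
        have : (lift sat_q1).comp qh = (AlgHom.id ℝ ℍ[ℝ]).prod (AlgHom.id ℝ ℍ[ℝ]) := by
          apply Quaternion.hom_ext
          · exact (congrArg _ qh_i).trans (lift_gen sat_q1 0 (by omega))
          · exact (congrArg _ qh_j).trans (lift_gen sat_q1 1 (by omega))
        exact DFunLike.congr_fun this a
      apply AlgHom.ext
      rintro ⟨a, b⟩
      rw [AlgHom.comp_apply, baseH_apply]
      simp only [map_smul, map_add, map_mul, map_sub, map_one, hq, lift_gen sat_q1 2 (by omega)]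
      have half : ∀ a : ℍ[ℝ], (1 / 2 : ℝ) • (a * (1 + 1)) = a := by
        intro a; rw [mul_add, mul_one, ← two_smul ℝ a, smul_smul]; norm_num
      ext1
      · simp only [q1, AlgHom.id_apply, Prod.smul_fst, Prod.fst_add, Prod.fst_mul, Prod.fst_sub,
          Prod.fst_one, sub_self, mul_zero, add_zero]
        exact half a
      · simp only [q1, AlgHom.id_apply, Prod.smul_snd, Prod.snd_add, Prod.snd_mul, Prod.snd_sub,
          Prod.snd_one, add_neg_cancel, sub_neg_eq_add, mul_zero, zero_add]
        exact half b)
    (by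
      apply hom_ext
      intro i hi
      have half : ∀ a : A 1, (1 / 2 : ℝ) • (a + a) = a := by
        intro a; rw [← two_smul ℝ a, smul_smul]; norm_num
      rw [AlgHom.comp_apply, lift_gen _ i hi, baseH_apply, AlgHom.id_apply]
      have hi' : i ≤ 2 := hi
      interval_cases i
      · simp only [q1]
        rw [qh_i, ← mul_add, add_add_sub_cancel, mul_add, mul_one, half]
      · simp only [q1]
        rw [qh_j, ← mul_add, add_add_sub_cancel, mul_add, mul_one, half]
      · simp only [q1, map_neg, map_one, one_mul, neg_mul]
        rw [neg_sub, add_comm (1 : A 1), add_add_sub_cancel, half])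

theorem main (m : ℕ) : Nonempty (A (m + 1) ≃ₐ[ℝ]
      (Matrix (Fin (2 ^ m)) (Fin (2 ^ m)) ℍ[ℝ] × Matrix (Fin (2 ^ m)) (Fin (2 ^ m)) ℍ[ℝ])) := by
  induction m with
  | zero =>
    have hb : Function.Bijective (Matrix.scalarAlgHom (Fin 1) ℝ : ℍ[ℝ] →ₐ[ℝ] _) := by
      constructor
      · intro a b h
        have := congrFun (congrFun h 0) 0
        simpa using this
      · intro M
        refine ⟨M 0 0, ?_⟩
        ext1 i j
        fin_cases i
        fin_cases j
        simp
    have e : Matrix (Fin (2 ^ 0)) (Fin (2 ^ 0)) ℍ[ℝ] ≃ₐ[ℝ] ℍ[ℝ] :=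
      (Matrix.reindexAlgEquiv ℝ ℍ[ℝ] (finCongr (pow_zero 2))).trans
        (AlgEquiv.ofBijective (Matrix.scalarAlgHom (Fin 1) ℝ : ℍ[ℝ] →ₐ[ℝ] _) hb).symm
    exact ⟨baseEquiv.trans (AlgEquiv.prodCongr e.symm e.symm)⟩
  | succ m ih =>
    obtain ⟨e⟩ := ih
    have r : Matrix (Fin 2) (Fin 2) (Matrix (Fin (2 ^ m)) (Fin (2 ^ m)) ℍ[ℝ]) ≃ₐ[ℝ]
        Matrix (Fin (2 ^ (m + 1))) (Fin (2 ^ (m + 1))) ℍ[ℝ] :=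
      (Matrix.compAlgEquiv _ _ _ ℝ).trans (Matrix.reindexAlgEquiv ℝ ℍ[ℝ]
        (finProdFinEquiv.trans (finCongr (by ring))))
    exact ⟨(stepEquiv (m + 1) (by omega)).trans ((AlgEquiv.mapMatrix e).trans
      ((prodMat _ _ _).trans (AlgEquiv.prodCongr r r)))⟩

end Tw

theorem twisted_mu1_odd_iso_prod_matrix_quaternion (n : ℕ) (hn : 1 ≤ n) :
    Nonempty (RingQuot (Rel13 n) ≃ₐ[ℝ]
      (Matrix (Fin (2 ^ (n - 1))) (Fin (2 ^ (n - 1))) (Quaternion ℝ) ×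
        Matrix (Fin (2 ^ (n - 1))) (Fin (2 ^ (n - 1))) (Quaternion ℝ))) := by
  obtain ⟨m, rfl⟩ : ∃ m, n = m + 1 := ⟨n - 1, by omega⟩
  exact Tw.main m
end
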